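/- arXiv:1604.00145 — 5 statements merged into one kernel-verified Lean document; each statement's English description precedes it below -/
import Mathlib

section
/- Let Λ be a non-coherence-generating channel on d-dimensional states. Then for every d×d density matrix ρ, the relative entropy of coherence satisfies C_r(Λ(ρ)) ≤ C_r(ρ). -/
open Matrix BigOperators Kronecker ComplexOrder

/-- Base-2 Shannon entropy of a probability vector, with the convention `0 · log 0 = 0`
(automatic since `Real.logb 2 0 = 0`). -/
noncomputable def shannon2 {n : Type*} [Fintype n] (p : n → ℝ) : ℝ :=
  -∑ i, p i * Real.logb 2 (p i)

/-- A density matrix: positive semidefinite with unit trace. -/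
def IsDensityMatrix {n : Type*} [Fintype n] (ρ : Matrix n n ℂ) : Prop :=
  ρ.PosSemidef ∧ ρ.trace = 1

/-- Von Neumann entropy (base 2): Shannon entropy of the eigenvalues. -/
noncomputable def vN {n : Type*} [Fintype n] [DecidableEq n] (ρ : Matrix n n ℂ) : ℝ :=
  if h : ρ.IsHermitian then shannon2 h.eigenvalues else 0

/-- Relative entropy of coherence `C_r(ρ) = S(Δ(ρ)) - S(ρ)`, where `Δ` is the
diagonal part. -/
noncomputable def Cr {n : Type*} [Fintype n] [DecidableEq n] (ρ : Matrix n n ℂ) : ℝ :=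
  vN (Matrix.diagonal ρ.diag) - vN ρ

/-- Application of a channel given by its Kraus operators: `ρ ↦ ∑ i, K i * ρ * (K i)ᴴ`. -/
noncomputable def krausApply {ι m p : Type*} [Fintype ι] [Fintype m] [Fintype p]
    (K : ι → Matrix p m ℂ) (ρ : Matrix m m ℂ) : Matrix p p ℂ :=
  ∑ i, K i * ρ * (K i)ᴴ

/-- Coherence of formation: infimum over finite pure-state decompositions
`ρ = ∑ i, p i • |ψ i⟩⟨ψ i|` of `∑ i, p i * S(Δ(|ψ i⟩⟨ψ i|))`. -/
noncomputable def Cf {n : Type*} [Fintype n] (ρ : Matrix n n ℂ) : ℝ :=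
  sInf { x : ℝ | ∃ (m : ℕ) (p : Fin m → ℝ) (ψ : Fin m → n → ℂ),
    (∀ i, 0 < p i) ∧ (∑ i, p i = 1) ∧ (∀ i, ∑ j, ‖ψ i j‖ ^ 2 = 1) ∧
    ρ = ∑ i, (p i : ℂ) • Matrix.vecMulVec (ψ i) (star (ψ i)) ∧
    x = ∑ i, p i * shannon2 (fun j => ‖ψ i j‖ ^ 2) }


namespace CrProof

variable {n : Type*} [Fintype n] [DecidableEq n]

/-- the variational functional -/
noncomputable def Qf (ρ σ : Matrix n n ℂ) (t : ℝ) (X : Matrix n n ℂ) : ℝ :=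
  2 * ((ρ * X).trace).re - ((σ * (X * Xᴴ)).trace).re - t * ((ρ * (Xᴴ * X)).trace).re

noncomputable def Ff (U : Matrix n n ℂ) (p q : n → ℝ) (t : ℝ) : ℝ :=
  ∑ i, ∑ j, Complex.normSq (U j i) * p i * (p i / (q j + t * p i))

noncomputable def Gf (U : Matrix n n ℂ) (p q : n → ℝ) (t : ℝ) : ℝ :=
  ∑ i, ∑ j, Complex.normSq (U j i) * p i * Real.log (q j + t * p i)

lemma Qf_expand (U : Matrix n n ℂ) (hU : Uᴴ * U = 1) (p q : n → ℝ) (t : ℝ) (M : Matrix n n ℂ) :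
    Qf (U * diagonal (fun i => (p i : ℂ)) * Uᴴ) (diagonal (fun i => (q i : ℂ))) t (M * Uᴴ) =
    ∑ i, ∑ j, (2 * p i * (star (U j i) * M j i).re - (q j + t * p i) * Complex.normSq (M j i)) := by
  have h1 : (U * diagonal (fun i => (p i : ℂ)) * Uᴴ * (M * Uᴴ)).trace
      = (diagonal (fun i => (p i : ℂ)) * (Uᴴ * M)).trace := by
    have : U * diagonal (fun i => (p i : ℂ)) * Uᴴ * (M * Uᴴ)
      = U * (diagonal (fun i => (p i : ℂ)) * (Uᴴ * M) * Uᴴ) := by simp only [Matrix.mul_assoc]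
    rw [this, Matrix.trace_mul_comm, Matrix.mul_assoc, hU, Matrix.mul_one]
  have h2 : (M * Uᴴ) * (M * Uᴴ)ᴴ = M * Mᴴ := by
    rw [conjTranspose_mul, conjTranspose_conjTranspose, Matrix.mul_assoc, ← Matrix.mul_assoc Uᴴ,
      hU, Matrix.one_mul]
  have h3 : (U * diagonal (fun i => (p i : ℂ)) * Uᴴ * ((M * Uᴴ)ᴴ * (M * Uᴴ))).trace
      = (diagonal (fun i => (p i : ℂ)) * (Mᴴ * M)).trace := by
    have : U * diagonal (fun i => (p i : ℂ)) * Uᴴ * ((M * Uᴴ)ᴴ * (M * Uᴴ))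
      = U * (diagonal (fun i => (p i : ℂ)) * ((Uᴴ * U) * Mᴴ * M) * Uᴴ) := by
      simp only [Matrix.mul_assoc, conjTranspose_mul, conjTranspose_conjTranspose]
    rw [this, Matrix.trace_mul_comm, Matrix.mul_assoc, hU, Matrix.mul_one, Matrix.one_mul]
  unfold Qf
  rw [h1, h2, h3]
  have g : ∀ (v : n → ℝ) (A : Matrix n n ℂ),
      ((diagonal (fun i => (v i : ℂ)) * A).trace).re = ∑ i, v i * (A i i).re := by
    intro v A
    rw [Matrix.trace, Complex.re_sum]
    refine Finset.sum_congr rfl fun i _ => ?_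
    rw [Matrix.diag_apply, Matrix.diagonal_mul, Complex.re_ofReal_mul]
  have g2 : ∑ j, q j * ((M * Mᴴ) j j).re = ∑ i, ∑ j, q j * (M j i * star (M j i)).re := by
    rw [Finset.sum_comm]
    refine Finset.sum_congr rfl fun j _ => ?_
    rw [Matrix.mul_apply, Complex.re_sum, Finset.mul_sum]
    rfl
  rw [g, g, g, g2]
  simp only [Matrix.mul_apply, conjTranspose_apply, Complex.re_sum, Finset.mul_sum]
  rw [← Finset.sum_sub_distrib, ← Finset.sum_sub_distrib]
  refine Finset.sum_congr rfl fun i _ => ?_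
  rw [← Finset.sum_sub_distrib, ← Finset.sum_sub_distrib]
  refine Finset.sum_congr rfl fun j _ => ?_
  simp only [Complex.mul_re, Complex.normSq_apply, Complex.star_def, Complex.conj_re,
    Complex.conj_im]
  ring

lemma quad_le (p c : ℝ) (u m : ℂ) (hc : 0 ≤ c) (h : p = 0 ∨ 0 < c) :
    2 * p * (star u * m).re - c * Complex.normSq m ≤ Complex.normSq u * p * (p / c) := by
  rcases h with rfl | h
  · simp; exact mul_nonneg hc (Complex.normSq_nonneg _)
  · rw [← mul_div_assoc, le_div_iff₀ h]
    simp only [Complex.mul_re, Complex.normSq_apply, Complex.star_def, Complex.conj_re,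
      Complex.conj_im]
    nlinarith [sq_nonneg (c * m.re - p * u.re), sq_nonneg (c * m.im - p * u.im)]

lemma quad_eq (p c : ℝ) (u : ℂ) (h : p = 0 ∨ 0 < c) :
    2 * p * (star u * (((p / c : ℝ) : ℂ) * u)).re - c * Complex.normSq (((p / c : ℝ) : ℂ) * u)
      = Complex.normSq u * p * (p / c) := by
  rcases h with rfl | h
  · simp
  · simp only [Complex.mul_re, Complex.normSq_apply, Complex.star_def, Complex.conj_re,
      Complex.conj_im, Complex.ofReal_re, Complex.ofReal_im, Complex.mul_im]
    field_simp
    ring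

lemma c_pos {p q : n → ℝ} (hp : ∀ i, 0 ≤ p i) (hq : ∀ i, 0 ≤ q i) {t : ℝ} (ht : 0 < t) (i j : n) :
    p i = 0 ∨ 0 < q j + t * p i := by
  rcases (hp i).eq_or_lt with h | h
  · exact Or.inl h.symm
  · right; have := hq j; positivity

lemma Qf_le (U : Matrix n n ℂ) (hU : Uᴴ * U = 1) (p q : n → ℝ) (hp : ∀ i, 0 ≤ p i)
    (hq : ∀ i, 0 ≤ q i) (t : ℝ) (ht : 0 < t) (X : Matrix n n ℂ) :
    Qf (U * diagonal (fun i => (p i : ℂ)) * Uᴴ) (diagonal (fun i => (q i : ℂ))) t X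
      ≤ Ff U p q t := by
  have hX : X = (X * U) * Uᴴ := by
    rw [Matrix.mul_assoc, mul_eq_one_comm.mp hU, Matrix.mul_one]
  rw [hX, Qf_expand U hU]
  refine Finset.sum_le_sum fun i _ => Finset.sum_le_sum fun j _ => ?_
  exact quad_le _ _ _ _ (add_nonneg (hq j) (mul_nonneg ht.le (hp i))) (c_pos hp hq ht i j)

lemma Qf_eq (U : Matrix n n ℂ) (hU : Uᴴ * U = 1) (p q : n → ℝ) (hp : ∀ i, 0 ≤ p i)
    (hq : ∀ i, 0 ≤ q i) (t : ℝ) (ht : 0 < t) : ∃ X : Matrix n n ℂ,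
    Qf (U * diagonal (fun i => (p i : ℂ)) * Uᴴ) (diagonal (fun i => (q i : ℂ))) t X
      = Ff U p q t := by
  refine ⟨Matrix.of (fun j i => ((p i / (q j + t * p i) : ℝ) : ℂ) * U j i) * Uᴴ, ?_⟩
  rw [Qf_expand U hU]
  refine Finset.sum_congr rfl fun i _ => Finset.sum_congr rfl fun j _ => ?_
  exact quad_eq _ _ _ (c_pos hp hq ht i j)

lemma trace_kraus {N : ℕ} (K : Fin N → Matrix n n ℂ) (ρ X : Matrix n n ℂ) :
    (krausApply K ρ * X).trace = (ρ * ∑ k, (K k)ᴴ * X * K k).trace := by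
  unfold krausApply
  rw [Finset.sum_mul, Finset.mul_sum, trace_sum, trace_sum]
  refine Finset.sum_congr rfl fun k _ => ?_
  rw [Matrix.mul_assoc, Matrix.mul_assoc, Matrix.trace_mul_comm]
  simp only [Matrix.mul_assoc]

lemma trace_mul_psd {ρ : Matrix n n ℂ} (hρ : ρ.PosSemidef) (A : Matrix n n ℂ) :
    0 ≤ ((ρ * (A * Aᴴ)).trace).re := by
  have := (hρ.conjTranspose_mul_mul_same A).trace_nonneg
  rw [← Matrix.mul_assoc, Matrix.trace_mul_comm, ← Matrix.mul_assoc]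
  exact (Complex.nonneg_iff.mp this).1

lemma schwarz {N : ℕ} (K : Fin N → Matrix n n ℂ) (hK : ∑ i, (K i)ᴴ * K i = 1)
    {ρ : Matrix n n ℂ} (hρ : ρ.PosSemidef) (X : Matrix n n ℂ) :
    ((ρ * ((∑ k, (K k)ᴴ * X * K k) * (∑ k, (K k)ᴴ * X * K k)ᴴ)).trace).re ≤
      ((krausApply K ρ * (X * Xᴴ)).trace).re := by
  rw [trace_kraus]
  set Y := ∑ k, (K k)ᴴ * X * K k with hY
  have hYh : Yᴴ = ∑ k, (K k)ᴴ * Xᴴ * K k := by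
    rw [hY, conjTranspose_sum]
    simp only [conjTranspose_mul, conjTranspose_conjTranspose, Matrix.mul_assoc]
  have key : ∑ k, ((K k)ᴴ * X - Y * (K k)ᴴ) * ((K k)ᴴ * X - Y * (K k)ᴴ)ᴴ
      = ∑ k, (K k)ᴴ * (X * Xᴴ) * K k - Y * Yᴴ := by
    have e : ∀ k, ((K k)ᴴ * X - Y * (K k)ᴴ) * ((K k)ᴴ * X - Y * (K k)ᴴ)ᴴ
      = (K k)ᴴ * (X * Xᴴ) * K k - ((K k)ᴴ * X * K k) * Yᴴ - Y * ((K k)ᴴ * Xᴴ * K k)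
        + Y * ((K k)ᴴ * K k) * Yᴴ := by
      intro k
      simp only [conjTranspose_sub, conjTranspose_mul, conjTranspose_conjTranspose]
      noncomm_ring
    simp only [e, Finset.sum_add_distrib, Finset.sum_sub_distrib]
    rw [← Finset.sum_mul, ← Finset.mul_sum, ← Finset.sum_mul, ← Finset.mul_sum, hK, ← hY, ← hYh]
    noncomm_ring
  have h0 : 0 ≤ ((ρ * (∑ k, (K k)ᴴ * (X * Xᴴ) * K k - Y * Yᴴ)).trace).re := by
    rw [← key, Finset.mul_sum, trace_sum, Complex.re_sum]
    exact Finset.sum_nonneg fun k _ => trace_mul_psd hρ _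
  rw [Matrix.mul_sub, trace_sub, Complex.sub_re] at h0
  linarith

lemma schwarz' {N : ℕ} (K : Fin N → Matrix n n ℂ) (hK : ∑ i, (K i)ᴴ * K i = 1)
    {ρ : Matrix n n ℂ} (hρ : ρ.PosSemidef) (X : Matrix n n ℂ) :
    ((ρ * ((∑ k, (K k)ᴴ * X * K k)ᴴ * (∑ k, (K k)ᴴ * X * K k))).trace).re ≤
      ((krausApply K ρ * (Xᴴ * X)).trace).re := by
  have := schwarz K hK hρ Xᴴ
  have hYh : (∑ k, (K k)ᴴ * X * K k)ᴴ = ∑ k, (K k)ᴴ * Xᴴ * K k := by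
    rw [conjTranspose_sum]
    simp only [conjTranspose_mul, conjTranspose_conjTranspose, Matrix.mul_assoc]
  rw [← hYh] at this
  simpa using this

lemma Qf_mono {N : ℕ} (K : Fin N → Matrix n n ℂ) (hK : ∑ i, (K i)ᴴ * K i = 1)
    {ρ σ : Matrix n n ℂ} (hρ : ρ.PosSemidef) (hσ : σ.PosSemidef) (t : ℝ) (ht : 0 < t)
    (X : Matrix n n ℂ) :
    Qf (krausApply K ρ) (krausApply K σ) t X ≤ Qf ρ σ t (∑ k, (K k)ᴴ * X * K k) := by
  unfold Qf
  have h1 := schwarz K hK hσ X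
  have h2 := mul_le_mul_of_nonneg_left (schwarz' K hK hρ X) ht.le
  rw [trace_kraus K ρ X]
  linarith

lemma Gf_deriv (U : Matrix n n ℂ) (p q : n → ℝ) (hp : ∀ i, 0 ≤ p i)
    (hq : ∀ i, 0 ≤ q i) (t : ℝ) (ht : 0 < t) : HasDerivAt (Gf U p q) (Ff U p q t) t := by
  unfold Gf Ff
  refine HasDerivAt.fun_sum fun i _ => HasDerivAt.fun_sum fun j _ => ?_
  rcases c_pos hp hq ht i j with h | h
  · simp only [h]; simpa using hasDerivAt_const t (0 : ℝ)
  · refine HasDerivAt.const_mul _ ?_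
    refine HasDerivAt.log ?_ h.ne'
    simpa using ((hasDerivAt_id t).mul_const (p i)).const_add (q j)

lemma Gf_mono (U V : Matrix n n ℂ) (p q p' q' : n → ℝ) (hp : ∀ i, 0 ≤ p i)
    (hq : ∀ i, 0 ≤ q i) (hp' : ∀ i, 0 ≤ p' i) (hq' : ∀ i, 0 ≤ q' i)
    (h : ∀ t, 0 < t → Ff V p' q' t ≤ Ff U p q t) {e T : ℝ} (he : 0 < e) (hT : e ≤ T) :
    Gf V p' q' T - Gf V p' q' e ≤ Gf U p q T - Gf U p q e := by
  have hd : ∀ t, 0 < t → HasDerivAt (fun t => Gf U p q t - Gf V p' q' t)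
      (Ff U p q t - Ff V p' q' t) t := fun t ht =>
    (Gf_deriv U p q hp hq t ht).sub (Gf_deriv V p' q' hp' hq' t ht)
  have hm : MonotoneOn (fun t => Gf U p q t - Gf V p' q' t) (Set.Ioi 0) := by
    refine monotoneOn_of_deriv_nonneg (convex_Ioi 0) ?_ ?_ ?_
    · exact fun t ht => (hd t ht).continuousAt.continuousWithinAt
    · rw [interior_Ioi]
      exact fun t ht => (hd t ht).differentiableAt.differentiableWithinAt
    · rw [interior_Ioi]
      intro t ht
      rw [(hd t ht).deriv]
      have := h t ht
      linarith
  have := hm (Set.mem_Ioi.mpr he) (Set.mem_Ioi.mpr (he.trans_le hT)) hT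
  simp only at this
  linarith

lemma colsum (U : Matrix n n ℂ) (hU : Uᴴ * U = 1) (i : n) : ∑ j, Complex.normSq (U j i) = 1 := by
  have := congrFun (congrFun hU i) i
  rw [Matrix.mul_apply, Matrix.one_apply_eq] at this
  have h2 := congrArg Complex.re this
  rw [Complex.re_sum, Complex.one_re] at h2
  rw [← h2]
  refine Finset.sum_congr rfl fun j _ => ?_
  simp [Complex.normSq_apply]

lemma Gf_lim (U : Matrix n n ℂ) (hU : Uᴴ * U = 1) (p q : n → ℝ) (hp : ∀ i, 0 ≤ p i)
    (hq : ∀ i, 0 ≤ q i) (hs : ∑ i, p i = 1) :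
    Filter.Tendsto (fun T => Gf U p q T - Real.log T) Filter.atTop
      (nhds (∑ i, p i * Real.log (p i))) := by
  have e1 : ∑ i, p i * Real.log (p i) =
      ∑ i, ∑ j, Complex.normSq (U j i) * p i * Real.log (p i) := by
    refine Finset.sum_congr rfl fun i _ => ?_
    rw [← Finset.sum_mul, ← Finset.sum_mul, colsum U hU, one_mul]
  have e2 : (fun T => Gf U p q T - Real.log T) =ᶠ[Filter.atTop]
      fun T => ∑ i, ∑ j, Complex.normSq (U j i) * p i * Real.log (q j / T + p i) := by
    filter_upwards [Filter.eventually_gt_atTop 0] with T hT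
    have e3 : Real.log T = ∑ i, ∑ j, Complex.normSq (U j i) * p i * Real.log T := by
      simp only [← Finset.sum_mul, colsum U hU, one_mul, hs]
    rw [e3]
    unfold Gf
    rw [← Finset.sum_sub_distrib]
    refine Finset.sum_congr rfl fun i _ => ?_
    rw [← Finset.sum_sub_distrib]
    refine Finset.sum_congr rfl fun j _ => ?_
    rcases c_pos hp hq hT i j with h | h
    · simp [h]
    · rw [← mul_sub, ← Real.log_div h.ne' hT.ne']
      congr 2
      field_simp
  rw [e1]
  refine Filter.Tendsto.congr' e2.symm ?_
  refine tendsto_finsetSum _ fun i _ => tendsto_finsetSum _ fun j _ => ?_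
  rcases (hp i).eq_or_lt with h | h
  · simp [← h]
  · refine Filter.Tendsto.const_mul _ ?_
    refine Filter.Tendsto.log ?_ h.ne'
    simpa using ((tendsto_const_nhds (x := q j)).div_atTop Filter.tendsto_id).add_const (p i)

lemma Gf_lower (U : Matrix n n ℂ) (p q : n → ℝ) (hp : ∀ i, 0 ≤ p i)
    (hq : ∀ j, q j = ∑ i, Complex.normSq (U j i) * p i) (e : ℝ) (he : 0 < e) :
    ∑ j, q j * Real.log (q j) ≤ Gf U p q e := by
  have h0 : ∀ i j, 0 ≤ Complex.normSq (U j i) * p i :=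
    fun i j => mul_nonneg (Complex.normSq_nonneg _) (hp i)
  unfold Gf
  rw [Finset.sum_comm]
  refine Finset.sum_le_sum fun j _ => ?_
  have hqj : 0 ≤ q j := by rw [hq]; exact Finset.sum_nonneg fun i _ => h0 i j
  rcases hqj.eq_or_lt with h | h
  · rw [← h, zero_mul]
    refine Finset.sum_nonneg fun i _ => ?_
    have := (Finset.sum_eq_zero_iff_of_nonneg (fun i _ => h0 i j)).mp ((hq j).symm.trans h.symm) i
      (Finset.mem_univ i)
    rw [this, zero_mul]
  · calc q j * Real.log (q j) = ∑ i, Complex.normSq (U j i) * p i * Real.log (q j) := by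
          rw [← Finset.sum_mul, ← hq]
      _ ≤ _ := by
          refine Finset.sum_le_sum fun i _ => mul_le_mul_of_nonneg_left ?_ (h0 i j)
          exact Real.log_le_log h (by have := mul_nonneg he.le (hp i); linarith)

lemma gibbs (r s : ℝ) (hr : 0 ≤ r) (hs : 0 < s) : r * Real.log s ≤ r * Real.log r + (s - r) := by
  rcases hr.eq_or_lt with h | h
  · rw [← h]; simp; exact hs.le
  · have := Real.log_le_sub_one_of_pos (div_pos hs h)
    rw [Real.log_div hs.ne' h.ne'] at this
    have h2 := mul_le_mul_of_nonneg_left this hr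
    have : r * (s / r - 1) = s - r := by field_simp
    linarith

lemma Gf_upper (U : Matrix n n ℂ) (p q r : n → ℝ) (hp : ∀ i, 0 ≤ p i) (hp1 : ∑ i, p i = 1)
    (hq : ∀ i, 0 ≤ q i) (hr : ∀ j, r j = ∑ i, Complex.normSq (U j i) * p i)
    (hqr : ∑ i, q i = ∑ i, r i) (e : ℝ) (he : 0 < e) :
    Gf U p q e ≤ ∑ j, r j * Real.log (r j) + Fintype.card n * e := by
  have h0 : ∀ i j, 0 ≤ Complex.normSq (U j i) * p i :=
    fun i j => mul_nonneg (Complex.normSq_nonneg _) (hp i)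
  have hple : ∀ i, p i ≤ 1 := fun i => by
    rw [← hp1]; exact Finset.single_le_sum (fun i _ => hp i) (Finset.mem_univ i)
  have a : Gf U p q e ≤ ∑ j, r j * Real.log (q j + e) := by
    unfold Gf
    rw [Finset.sum_comm]
    refine Finset.sum_le_sum fun j _ => ?_
    rw [hr j, Finset.sum_mul]
    refine Finset.sum_le_sum fun i _ => ?_
    rcases c_pos hp hq he i j with h | h
    · simp [h]
    · refine mul_le_mul_of_nonneg_left (Real.log_le_log h ?_) (h0 i j)
      nlinarith [hple i]
  have b : ∑ j, r j * Real.log (q j + e) ≤ ∑ j, (r j * Real.log (r j) + (q j + e - r j)) := by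
    refine Finset.sum_le_sum fun j _ => gibbs _ _ ?_ (by have := hq j; linarith)
    rw [hr]; exact Finset.sum_nonneg fun i _ => h0 i j
  refine (a.trans b).trans (le_of_eq ?_)
  rw [Finset.sum_add_distrib, Finset.sum_sub_distrib, Finset.sum_add_distrib, hqr]
  simp

lemma main_real (U V : Matrix n n ℂ) (hU : Uᴴ * U = 1) (hV : Vᴴ * V = 1)
    (p q p' q' r : n → ℝ) (hp : ∀ i, 0 ≤ p i) (hp1 : ∑ i, p i = 1)
    (hq : ∀ j, q j = ∑ i, Complex.normSq (U j i) * p i)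
    (hp' : ∀ i, 0 ≤ p' i) (hp1' : ∑ i, p' i = 1) (hq' : ∀ i, 0 ≤ q' i)
    (hr : ∀ j, r j = ∑ i, Complex.normSq (V j i) * p' i)
    (hqr : ∑ i, q' i = ∑ i, r i)
    (h : ∀ t, 0 < t → Ff V p' q' t ≤ Ff U p q t) :
    ∑ i, p' i * Real.log (p' i) - ∑ i, r i * Real.log (r i) ≤
      ∑ i, p i * Real.log (p i) - ∑ i, q i * Real.log (q i) := by
  have hq0 : ∀ j, 0 ≤ q j := fun j => by
    rw [hq]; exact Finset.sum_nonneg fun i _ => mul_nonneg (Complex.normSq_nonneg _) (hp i)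
  have main : ∀ e : ℝ, 0 < e → ∑ i, p' i * Real.log (p' i) - ∑ i, r i * Real.log (r i) ≤
      ∑ i, p i * Real.log (p i) - ∑ i, q i * Real.log (q i) + Fintype.card n * e := by
    intro e he
    have l := le_of_tendsto_of_tendsto
      ((Gf_lim V hV p' q' hp' hq' hp1').sub_const (Gf V p' q' e))
      ((Gf_lim U hU p q hp hq0 hp1).sub_const (Gf U p q e)) (by
        filter_upwards [Filter.eventually_ge_atTop e] with T hT
        have := Gf_mono U V p q p' q' hp hq0 hp' hq' h he hT
        linarith)
    have l1 := Gf_lower U p q hp hq e he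
    have l2 := Gf_upper V p' q' r hp' hp1' hq' hr hqr e he
    linarith
  refine le_of_forall_pos_le_add fun δ hδ => ?_
  have hc : (0 : ℝ) < Fintype.card n + 1 := by positivity
  have := main (δ / (Fintype.card n + 1)) (div_pos hδ hc)
  have h2 : (Fintype.card n : ℝ) * (δ / (Fintype.card n + 1)) ≤ δ := by
    rw [← mul_div_assoc, div_le_iff₀ hc]
    nlinarith
  linarith

lemma vN_diag (q : n → ℝ) : vN (diagonal (fun i => (q i : ℂ))) = shannon2 q := by
  have hH : (diagonal (fun i => (q i : ℂ))).IsHermitian := by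
    refine isHermitian_diagonal_of_self_adjoint _ ?_
    ext i; simp
  unfold vN
  rw [dif_pos hH]
  have h1 := hH.roots_charpoly_eq_eigenvalues
  rw [charpoly_diagonal, Polynomial.roots_prod _ _
    (Finset.prod_ne_zero_iff.mpr fun i _ => Polynomial.X_sub_C_ne_zero _)] at h1
  simp only [Polynomial.roots_X_sub_C, Multiset.bind_singleton] at h1
  have h2 := congrArg (fun s => (Multiset.map (fun z : ℂ => z.re * Real.logb 2 z.re) s).sum) h1
  simp only [Multiset.map_map] at h2
  unfold shannon2
  rw [neg_inj]
  exact h2.symm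

lemma shannon2_eq (p : n → ℝ) : shannon2 p = -(∑ i, p i * Real.log (p i)) / Real.log 2 := by
  unfold shannon2
  rw [neg_div, Finset.sum_div]
  simp only [Real.logb, mul_div_assoc]

lemma spectral (ρ : Matrix n n ℂ) (hρ : IsDensityMatrix ρ) :
    ∃ (U : Matrix n n ℂ) (p : n → ℝ), Uᴴ * U = 1 ∧ (∀ i, 0 ≤ p i) ∧ ∑ i, p i = 1 ∧
      ρ = U * diagonal (fun i => (p i : ℂ)) * Uᴴ ∧ vN ρ = shannon2 p ∧
      ∀ j, ρ j j = ((∑ i, Complex.normSq (U j i) * p i : ℝ) : ℂ) := by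
  have hH := hρ.1.isHermitian
  have hs : ρ = (hH.eigenvectorUnitary : Matrix n n ℂ) *
      diagonal (fun i => (hH.eigenvalues i : ℂ)) * (hH.eigenvectorUnitary : Matrix n n ℂ)ᴴ := by
    have := hH.spectral_theorem
    rw [Unitary.conjStarAlgAut_apply] at this
    exact this
  refine ⟨hH.eigenvectorUnitary, hH.eigenvalues, ?_, hρ.1.eigenvalues_nonneg, ?_, hs, ?_, ?_⟩
  · exact Unitary.coe_star_mul_self hH.eigenvectorUnitary
  · have := hH.trace_eq_sum_eigenvalues
    rw [hρ.2] at this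
    have h2 := congrArg Complex.re this
    simpa using h2.symm
  · unfold vN; rw [dif_pos hH]
  · intro j
    have := congrFun (congrFun hs j) j
    rw [this, Matrix.mul_apply]
    push_cast
    refine Finset.sum_congr rfl fun i _ => ?_
    rw [Matrix.mul_diagonal, conjTranspose_apply, Complex.normSq_eq_conj_mul_self, Complex.star_def]
    ring

lemma kraus_density {N : ℕ} (K : Fin N → Matrix n n ℂ) (hK : ∑ i, (K i)ᴴ * K i = 1)
    {ρ : Matrix n n ℂ} (hρ : IsDensityMatrix ρ) : IsDensityMatrix (krausApply K ρ) := by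
  constructor
  · exact posSemidef_sum _ fun k _ => hρ.1.mul_mul_conjTranspose_same _
  · have := trace_kraus K ρ 1
    simp only [Matrix.mul_one, hK] at this
    rw [this, hρ.2]

end CrProof

open CrProof in
/-- **Theorem 1.** The relative entropy of coherence never increases under any
non-coherence-generating channel. -/
theorem Cr_monotone_under_NC (d N : ℕ)
    (K : Fin N → Matrix (Fin d) (Fin d) ℂ)
    (hKraus : ∑ i, (K i)ᴴ * K i = 1)
    (hNC : ∀ σ : Matrix (Fin d) (Fin d) ℂ,
      IsDensityMatrix σ → σ.IsDiag → (krausApply K σ).IsDiag)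
    (ρ : Matrix (Fin d) (Fin d) ℂ) (hρ : IsDensityMatrix ρ) :
    Cr (krausApply K ρ) ≤ Cr ρ := by
  have hρ' := kraus_density K hKraus hρ
  obtain ⟨U, p, hU, hp, hp1, hs, hv, hd⟩ := spectral ρ hρ
  obtain ⟨V, p', hV, hp', hp1', hs', hv', hd'⟩ := spectral _ hρ'
  set q : Fin d → ℝ := fun j => ∑ i, Complex.normSq (U j i) * p i with hq
  set r : Fin d → ℝ := fun j => ∑ i, Complex.normSq (V j i) * p' i with hr
  have eq1 : ρ.diag = fun j => (q j : ℂ) := funext hd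
  have eq2 : (krausApply K ρ).diag = fun j => (r j : ℂ) := funext hd'
  have hq0 : ∀ j, 0 ≤ q j := fun j =>
    Finset.sum_nonneg fun i _ => mul_nonneg (Complex.normSq_nonneg _) (hp i)
  set σ : Matrix (Fin d) (Fin d) ℂ := diagonal (fun j => (q j : ℂ)) with hσd
  have hσ : IsDensityMatrix σ := by
    constructor
    · rw [hσd, posSemidef_diagonal_iff]
      exact fun i => Complex.zero_le_real.mpr (hq0 i)
    · rw [hσd, ← eq1, trace_diagonal]
      exact hρ.2
  have hσ' := kraus_density K hKraus hσ
  have hD := hNC σ hσ (isDiag_diagonal _)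
  set q' : Fin d → ℝ := fun j => (krausApply K σ j j).re with hq'
  have hq'c : ∀ j, krausApply K σ j j = (q' j : ℂ) := fun j => by
    have := Complex.nonneg_iff.mp (hσ'.1.diag_nonneg (i := j))
    apply Complex.ext
    · simp [hq']
    · simpa using this.2.symm
  have hσ'd : krausApply K σ = diagonal (fun j => (q' j : ℂ)) := by
    rw [← hD.diagonal_diag]
    congr 1
    exact funext hq'c
  have hq'0 : ∀ j, 0 ≤ q' j := fun j =>
    (Complex.nonneg_iff.mp (hσ'.1.diag_nonneg (i := j))).1
  have hqr : ∑ i, q' i = ∑ i, r i := by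
    have h1 : ((∑ i, q' i : ℝ) : ℂ) = 1 := by
      rw [← hσ'.2, hσ'd, trace_diagonal]; push_cast; rfl
    have h2 : ((∑ i, r i : ℝ) : ℂ) = 1 := by
      rw [← hρ'.2, Matrix.trace, eq2]; push_cast; rfl
    exact_mod_cast h1.trans h2.symm
  have key : ∀ t, 0 < t → Ff V p' q' t ≤ Ff U p q t := by
    intro t ht
    obtain ⟨X, hX⟩ := Qf_eq V hV p' q' hp' hq'0 t ht
    rw [← hs', ← hσ'd] at hX
    rw [← hX]
    refine (Qf_mono K hKraus hρ.1 hσ.1 t ht X).trans ?_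
    have := Qf_le U hU p q hp hq0 t ht (∑ k, (K k)ᴴ * X * K k)
    rwa [← hs] at this
  have fin := main_real U V hU hV p q p' q' r hp hp1 (fun _ => rfl) hp' hp1' hq'0 (fun _ => rfl)
    hqr key
  unfold Cr
  rw [eq1, eq2, vN_diag, vN_diag, hv, hv']
  simp only [shannon2_eq]
  rw [← sub_div, ← sub_div]
  refine div_le_div_of_nonneg_right ?_ (Real.log_nonneg (by norm_num))
  linarith
end

section
/- Let Λ be a non-coherence-generating channel from n-qubit states to m-qubit states (given by rectangular Kraus matrices K_j : ℂ^{2^n} → ℂ^{2^m} with ∑_j K_j† K_j = I_{2^n}, mapping every diagonal 2^n×2^n density matrix to a diagonal matrix). If ρ is a 2×2 density matrix such that Λ(ρ^{⊗n}) = Φ₂^{⊗m}, where Φ₂ = (1/2)∑_{i,j∈{0,1}} |i⟩⟨j| is the unit-coherence pure state, then m ≤ n·C_r(ρ). -/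
open Matrix BigOperators Kronecker ComplexOrder

/-- The `k`-fold Kronecker (tensor) power of a qubit matrix, as a matrix indexed by
`Fin k → Fin 2` (the computational product basis). -/
noncomputable def tpow (k : ℕ) (ρ : Matrix (Fin 2) (Fin 2) ℂ) :
    Matrix (Fin k → Fin 2) (Fin k → Fin 2) ℂ :=
  Matrix.of fun f g => ∏ i, ρ (f i) (g i)

/-- The unit-coherence pure state `Φ₂ = (1/2)∑_{i,j} |i⟩⟨j|`. -/
noncomputable def Phi2 : Matrix (Fin 2) (Fin 2) ℂ := Matrix.of fun _ _ => 1 / 2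

lemma real_core {α : Type*} [Fintype α] (W : α → α → ℝ) (l s : α → ℝ) (m : ℕ)
    (hW : ∀ x i, 0 ≤ W x i) (hl : ∀ i, 0 ≤ l i) (hl1 : ∑ i, l i = 1)
    (hWc : ∀ i, ∑ x, W x i = 1) (hs : ∀ x, s x = ∑ i, W x i * l i)
    (hle : ∑ x, s x * (∑ i, if 0 < l i then W x i else 0) ≤ (1 / 2 : ℝ) ^ m) :
    (m : ℝ) ≤ shannon2 s - shannon2 l := by
  have hs0 : ∀ x, 0 ≤ s x := fun x => by
    rw [hs]; exact Finset.sum_nonneg fun i _ => mul_nonneg (hW x i) (hl i)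
  have key : ∀ x i, l i * W x i * (Real.log (s x) + m * Real.log 2 - Real.log (l i)) ≤
      2 ^ m * (s x * (if 0 < l i then W x i else 0)) - l i * W x i := by
    intro x i
    by_cases h : 0 < l i
    · rw [if_pos h]
      rcases (hW x i).eq_or_lt with h0 | h0
      · simp [← h0]
      · have hsx : 0 < s x := by
          rw [hs]
          refine lt_of_lt_of_le (mul_pos h0 h) ?_
          exact Finset.single_le_sum (f := fun i => W x i * l i)
            (fun i _ => mul_nonneg (hW x i) (hl i)) (Finset.mem_univ i)
        have := Real.log_le_sub_one_of_pos (x := s x * 2 ^ m / l i) (by positivity)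
        rw [Real.log_div (by positivity) h.ne', Real.log_mul hsx.ne' (by positivity),
          Real.log_pow] at this
        calc _ ≤ l i * W x i * (s x * 2 ^ m / l i - 1) := by gcongr
          _ = _ := by field_simp
    · have : l i = 0 := le_antisymm (not_lt.mp h) (hl i)
      simp [this]
  have hsum := Finset.sum_le_sum fun x (_ : x ∈ Finset.univ) =>
    Finset.sum_le_sum fun i (_ : i ∈ Finset.univ) => key x i
  have e1 : ∑ x, ∑ i, l i * W x i = 1 := by
    rw [Finset.sum_comm]
    simp_rw [← Finset.mul_sum, hWc, mul_one, hl1]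
  have e2 : ∑ x, ∑ i, l i * W x i * Real.log (s x) = ∑ x, s x * Real.log (s x) := by
    refine Finset.sum_congr rfl fun x _ => ?_
    rw [← Finset.sum_mul, hs]
    simp_rw [mul_comm]
  have e3 : ∑ x, ∑ i, l i * W x i * Real.log (l i) = ∑ i, l i * Real.log (l i) := by
    rw [Finset.sum_comm]
    refine Finset.sum_congr rfl fun i _ => ?_
    rw [← Finset.sum_mul, ← Finset.mul_sum, hWc, mul_one]
  have e4 : ∑ x, ∑ i, l i * W x i * ((m : ℝ) * Real.log 2) = m * Real.log 2 := by
    simp_rw [← Finset.sum_mul]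
    rw [e1, one_mul]
  have e5 : ∑ x, ∑ i, (2 : ℝ) ^ m * (s x * (if 0 < l i then W x i else 0)) =
      2 ^ m * ∑ x, s x * (∑ i, if 0 < l i then W x i else 0) := by
    simp_rw [Finset.mul_sum]
  simp only [mul_sub, mul_add, Finset.sum_sub_distrib, Finset.sum_add_distrib] at hsum
  rw [e1, e2, e3, e4, e5] at hsum
  have h2 : (2:ℝ) ^ m * ∑ x, s x * (∑ i, if 0 < l i then W x i else 0) ≤ 1 := by
    calc _ ≤ (2:ℝ) ^ m * (1 / 2) ^ m := by gcongr
      _ = 1 := by rw [← mul_pow]; norm_num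
  have hlog : 0 < Real.log 2 := Real.log_pos (by norm_num)
  have f : ∀ p : α → ℝ, shannon2 p = -(∑ i, p i * Real.log (p i)) / Real.log 2 := by
    intro p
    simp only [shannon2, Real.logb]
    rw [neg_div, Finset.sum_div]
    simp_rw [mul_div_assoc]
  rw [f, f, ← sub_div, le_div_iff₀ hlog]
  linarith

lemma mat_core {α : Type*} [Fintype α] [DecidableEq α] (E V : Matrix α α ℂ) (l : α → ℝ)
    (hE : E.PosSemidef) (hE1 : (1 - E).PosSemidef) (hV : Vᴴ * V = 1)
    (hl : ∀ i, 0 ≤ l i) (hl1 : ∑ i, l i = 1)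
    (htr : (E * (V * diagonal (fun i => (l i : ℂ)) * Vᴴ)).trace = 1) (x : α) :
    (∑ i, if 0 < l i then ‖V x i‖ ^ 2 else 0) ≤ (E x x).re := by
  have hV' : V * Vᴴ = 1 := mul_eq_one_comm.mp hV
  have hH : (Vᴴ * E * V).PosSemidef := hE.conjTranspose_mul_mul_same V
  have hG : (Vᴴ * (1 - E) * V).PosSemidef := hE1.conjTranspose_mul_mul_same V
  have hGH : Vᴴ * (1 - E) * V = 1 - Vᴴ * E * V := by
    rw [Matrix.mul_sub, Matrix.sub_mul, Matrix.mul_one, hV]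
  have hEH : E = V * (Vᴴ * E * V) * Vᴴ := by
    calc E = (V * Vᴴ) * E * (V * Vᴴ) := by rw [hV']; simp
      _ = _ := by simp only [Matrix.mul_assoc]
  rw [hGH] at hG
  generalize Vᴴ * E * V = H at *
  subst hEH
  have ht : ∑ i, (1 - H) i i * (l i : ℂ) = 0 := by
    have h1 : (V * H * Vᴴ * (V * diagonal (fun i => (l i : ℂ)) * Vᴴ)) =
        V * (H * diagonal (fun i => (l i : ℂ))) * Vᴴ := by
      calc _ = V * H * (Vᴴ * V) * diagonal (fun i => (l i : ℂ)) * Vᴴ := by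
            simp only [Matrix.mul_assoc]
        _ = _ := by rw [hV]; simp only [Matrix.mul_assoc, Matrix.mul_one]
    rw [h1, Matrix.trace_mul_comm, ← Matrix.mul_assoc, hV, Matrix.one_mul] at htr
    simp only [Matrix.trace, Matrix.diag, Matrix.mul_diagonal] at htr
    simp only [Matrix.sub_apply, sub_mul, Matrix.one_apply_eq, one_mul, Finset.sum_sub_distrib, htr]
    have : ∑ i, (l i : ℂ) = 1 := by exact_mod_cast hl1
    rw [this, sub_self]
  have hdiag : ∀ i, 0 < l i → (1 - H) i i = 0 := by
    intro i hi
    have := (Finset.sum_eq_zero_iff_of_nonneg (fun i _ => mul_nonneg (hG.diag_nonneg (i := i))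
      (by exact_mod_cast hl i))).mp ht i (Finset.mem_univ i)
    rcases mul_eq_zero.mp this with h | h
    · exact h
    · exact absurd (by exact_mod_cast h) hi.ne'
  have hcol : ∀ i, 0 < l i → ∀ j, (1 - H) j i = 0 := by
    intro i hi j
    have := (hG.dotProduct_mulVec_zero_iff (Pi.single i 1)).mp (by
      rw [Matrix.mulVec_single_one]
      simp [hdiag i hi, -Matrix.sub_apply])
    rw [Matrix.mulVec_single_one] at this
    exact congrFun this j
  set D : Matrix α α ℂ := diagonal (fun i => if 0 < l i then 1 else 0) with hD
  have hHD : H * D = D := by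
    ext j i
    rw [hD, Matrix.mul_diagonal]
    by_cases h : 0 < l i
    · have := hcol i h j
      rw [Matrix.sub_apply, sub_eq_zero] at this
      rw [← this]
      by_cases hji : j = i
      · subst hji; simp
      · simp [hji]
    · by_cases hji : j = i
      · subst hji; simp [h]
      · simp [h, hji]
  have hDD : Dᴴ = D := by
    rw [hD, Matrix.diagonal_conjTranspose]
    congr 1; ext i
    simp only [Pi.star_apply]
    split_ifs <;> simp
  have hD2 : D * D = D := by
    rw [hD, Matrix.diagonal_mul_diagonal]
    congr 1; ext i; split_ifs <;> simp
  have hDH : D * H = D := by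
    have := congrArg Matrix.conjTranspose hHD
    rwa [Matrix.conjTranspose_mul, hDD, hH.1] at this
  have hpsd : (H - D).PosSemidef := by
    have := hH.conjTranspose_mul_mul_same (1 - D)
    have e : (1 - D)ᴴ * H * (1 - D) = H - D := by
      rw [Matrix.conjTranspose_sub, hDD, Matrix.conjTranspose_one, Matrix.sub_mul, Matrix.mul_sub,
        Matrix.one_mul, Matrix.mul_one, hDH, Matrix.sub_mul, hHD, hD2]
      simp
    rwa [e] at this
  have h3 := (hpsd.mul_mul_conjTranspose_same V).diag_nonneg (i := x)
  rw [Matrix.mul_sub, Matrix.sub_mul, Matrix.sub_apply] at h3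
  have h4 : (V * D * Vᴴ) x x = ((∑ i, if 0 < l i then ‖V x i‖ ^ 2 else 0 : ℝ) : ℂ) := by
    rw [Matrix.mul_apply]
    push_cast
    refine Finset.sum_congr rfl fun i _ => ?_
    rw [hD, Matrix.mul_diagonal]
    split_ifs
    · simp [Complex.mul_conj']
    · simp
  rw [h4] at h3
  have := (Complex.le_def.mp h3).1
  simp at this
  simpa using this

lemma tpow_mul (k : ℕ) (A B : Matrix (Fin 2) (Fin 2) ℂ) :
    tpow k (A * B) = tpow k A * tpow k B := by
  ext f g
  simp only [tpow, Matrix.of_apply, Matrix.mul_apply, ← Finset.prod_mul_distrib]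
  rw [Finset.prod_univ_sum]
  simp

lemma tpow_conjTranspose (k : ℕ) (A : Matrix (Fin 2) (Fin 2) ℂ) :
    tpow k Aᴴ = (tpow k A)ᴴ := by
  ext f g
  simp [tpow]

lemma tpow_diagonal (k : ℕ) (d : Fin 2 → ℂ) :
    tpow k (diagonal d) = diagonal (fun f => ∏ i, d (f i)) := by
  ext f g
  simp only [tpow, Matrix.of_apply]
  by_cases h : f = g
  · subst h; simp
  · rw [Matrix.diagonal_apply_ne _ h]
    obtain ⟨i, hi⟩ := Function.ne_iff.mp h
    exact Finset.prod_eq_zero (Finset.mem_univ i) (by simp [hi])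

lemma tpow_one (k : ℕ) : tpow k (1 : Matrix (Fin 2) (Fin 2) ℂ) = 1 := by
  rw [← Matrix.diagonal_one, tpow_diagonal]
  simp

lemma sum_prod_one (k : ℕ) (p : Fin 2 → ℝ) (hp : ∑ i, p i = 1) :
    ∑ f : Fin k → Fin 2, ∏ i, p (f i) = 1 := by
  have := Finset.prod_univ_sum (fun _ : Fin k => (Finset.univ : Finset (Fin 2))) (fun _ j => p j)
  simp only [Fintype.piFinset_univ] at this
  rw [← this, hp]; simp

lemma shannon_prod (k : ℕ) (p : Fin 2 → ℝ) (hp : ∑ i, p i = 1) :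
    shannon2 (fun f : Fin k → Fin 2 => ∏ i, p (f i)) = k * shannon2 p := by
  induction k with
  | zero => simp [shannon2]
  | succ k ih =>
    have key : ∀ (a : Fin 2) (f : Fin k → Fin 2),
        (p a * ∏ i, p (f i)) * Real.logb 2 (p a * ∏ i, p (f i)) =
        (p a * Real.logb 2 (p a)) * (∏ i, p (f i)) +
          p a * ((∏ i, p (f i)) * Real.logb 2 (∏ i, p (f i))) := by
      intro a f
      by_cases h1 : p a = 0
      · simp [h1]
      by_cases h2 : ∏ i, p (f i) = 0
      · simp [h2]
      rw [Real.logb_mul h1 h2]; ring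
    unfold shannon2 at ih ⊢
    rw [← (Fin.consEquiv (fun _ : Fin (k+1) => Fin 2)).sum_comp, Fintype.sum_prod_type]
    simp only [Fin.consEquiv, Equiv.coe_fn_mk, Fin.prod_univ_succ, Fin.cons_zero, Fin.cons_succ]
    simp_rw [key, Finset.sum_add_distrib, ← Finset.mul_sum, ← Finset.sum_mul]
    rw [sum_prod_one k p hp, hp]
    push_cast
    linarith

lemma vN_diagonal {α : Type*} [Fintype α] [DecidableEq α] (d : α → ℝ) :
    vN (diagonal fun i => (d i : ℂ)) = shannon2 d := by
  have h : (diagonal fun i => (d i : ℂ)).IsHermitian := by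
    rw [Matrix.IsHermitian, Matrix.diagonal_conjTranspose]
    congr 1; ext i; simp
  rw [vN, dif_pos h]
  have h1 := h.roots_charpoly_eq_eigenvalues
  rw [Matrix.charpoly_diagonal, Polynomial.roots_prod _ _ (by
    simp [Finset.prod_ne_zero_iff, Polynomial.X_sub_C_ne_zero])] at h1
  have h2 := congrArg (fun s => (s.map (fun z : ℂ => z.re * Real.logb 2 z.re)).sum) h1
  simp at h2
  simp only [shannon2, h2]

lemma Phi2_sq : Phi2 * Phi2 = Phi2 := by
  ext i j; simp [Phi2, Matrix.mul_apply]

lemma Phi2_conj : Phi2ᴴ = Phi2 := by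
  ext i j; simp [Phi2]

/-- If an NC channel maps `ρ^{⊗n}` exactly to `Φ₂^{⊗m}`, then `m ≤ n · C_r(ρ)`. -/
theorem NC_distillation_rate_le_Cr (n m N : ℕ)
    (K : Fin N → Matrix (Fin m → Fin 2) (Fin n → Fin 2) ℂ)
    (hKraus : ∑ j, (K j)ᴴ * K j = 1)
    (hNC : ∀ σ : Matrix (Fin n → Fin 2) (Fin n → Fin 2) ℂ,
      IsDensityMatrix σ → σ.IsDiag → (krausApply K σ).IsDiag)
    (ρ : Matrix (Fin 2) (Fin 2) ℂ) (hρ : IsDensityMatrix ρ)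
    (hout : krausApply K (tpow n ρ) = tpow m Phi2) :
    (m : ℝ) ≤ (n : ℝ) * Cr ρ := by
  have hρ1 := hρ.1
  set P := tpow m Phi2 with hP
  have hPP : P * P = P := by rw [hP, ← tpow_mul, Phi2_sq]
  have hPH : Pᴴ = P := by rw [hP, ← tpow_conjTranspose, Phi2_conj]
  have hPd : ∀ x, P x x = (1 / 2) ^ m := by intro x; simp [hP, tpow, Phi2]
  have hPtr : P.trace = 1 := by
    simp only [Matrix.trace, Matrix.diag, hPd]
    simp
  have hPpsd : P.PosSemidef := by
    have := Matrix.posSemidef_conjTranspose_mul_self P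
    rwa [hPH, hPP] at this
  have hP1psd : (1 - P).PosSemidef := by
    have := Matrix.posSemidef_conjTranspose_mul_self (1 - P)
    have e : (1 - P)ᴴ * (1 - P) = 1 - P := by
      rw [Matrix.conjTranspose_sub, hPH, Matrix.conjTranspose_one, Matrix.sub_mul, Matrix.mul_sub,
        Matrix.mul_sub, hPP]
      simp
    rwa [e] at this
  let E : Matrix (Fin n → Fin 2) (Fin n → Fin 2) ℂ := ∑ j, (K j)ᴴ * P * K j
  have hE : E.PosSemidef :=
    Matrix.posSemidef_sum _ fun j _ => hPpsd.conjTranspose_mul_mul_same (K j)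
  have hE1 : (1 - E).PosSemidef := by
    have e : 1 - E = ∑ j, (K j)ᴴ * (1 - P) * K j := by
      rw [← hKraus, ← Finset.sum_sub_distrib]
      simp only [Matrix.mul_sub, Matrix.sub_mul, Matrix.mul_one]
    rw [e]
    exact Matrix.posSemidef_sum _ fun j _ => hP1psd.conjTranspose_mul_mul_same (K j)
  have hdual : ∀ X, (E * X).trace = (P * krausApply K X).trace := by
    intro X
    simp only [E, krausApply, Finset.sum_mul, Finset.mul_sum, Matrix.trace_sum]
    refine Finset.sum_congr rfl fun j _ => ?_
    rw [Matrix.mul_assoc, Matrix.mul_assoc, Matrix.trace_mul_comm]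
    simp only [Matrix.mul_assoc]
  have htrK : ∀ X, (krausApply K X).trace = X.trace := by
    intro X
    calc (krausApply K X).trace = ((∑ j, (K j)ᴴ * K j) * X).trace := by
          simp only [krausApply, Finset.sum_mul, Matrix.trace_sum]
          refine Finset.sum_congr rfl fun j _ => ?_
          rw [Matrix.trace_mul_comm, Matrix.mul_assoc]
      _ = X.trace := by rw [hKraus, Matrix.one_mul]
  -- spectral data of the single-copy state
  let l : Fin 2 → ℝ := hρ1.1.eigenvalues
  let U : Matrix (Fin 2) (Fin 2) ℂ := hρ1.1.eigenvectorUnitary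
  have hU : Uᴴ * U = 1 := Unitary.coe_star_mul_self hρ1.1.eigenvectorUnitary
  have hspec : ρ = U * diagonal (fun i => (l i : ℂ)) * Uᴴ := by
    have := hρ1.1.spectral_theorem
    rw [Unitary.conjStarAlgAut_apply] at this
    exact this
  have hl : ∀ i, 0 ≤ l i := fun i => hρ1.eigenvalues_nonneg i
  have hl1 : ∑ i, l i = 1 := by
    have h := hρ1.1.trace_eq_sum_eigenvalues
    rw [hρ.2] at h
    have h' : ((∑ i, l i : ℝ) : ℂ) = 1 := by
      rw [Complex.ofReal_sum]; exact h.symm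
    exact_mod_cast h'
  let s : Fin 2 → ℝ := fun i => (ρ i i).re
  have hsρ : ∀ i, ρ i i = (s i : ℂ) := fun i =>
    ((Complex.nonneg_iff.mp (hρ1.diag_nonneg (i := i))).2 ▸ rfl : (ρ i i).im = 0) |> fun h => by
      apply Complex.ext <;> simp [s, h]
  have hs0 : ∀ i, 0 ≤ s i := fun i => (Complex.nonneg_iff.mp (hρ1.diag_nonneg (i := i))).1
  have hs1 : ∑ i, s i = 1 := by
    have h := hρ.2
    simp only [Matrix.trace, Matrix.diag, hsρ] at h
    exact_mod_cast h
  have hCr : Cr ρ = shannon2 s - shannon2 l := by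
    have e : ρ.diag = fun i => (s i : ℂ) := funext hsρ
    rw [Cr, e, vN_diagonal, vN, dif_pos hρ1.1]
  -- many-copy data
  let L : (Fin n → Fin 2) → ℝ := fun f => ∏ i, l (f i)
  let S : (Fin n → Fin 2) → ℝ := fun f => ∏ i, s (f i)
  let V := tpow n U
  have hV : Vᴴ * V = 1 := by
    simp only [V]; rw [← tpow_conjTranspose, ← tpow_mul, hU, tpow_one]
  have hR : tpow n ρ = V * diagonal (fun f => (L f : ℂ)) * Vᴴ := by
    conv_lhs => rw [hspec]
    rw [tpow_mul, tpow_mul, tpow_diagonal, tpow_conjTranspose]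
    simp only [V, L]
    push_cast
    rfl
  have hL : ∀ f, 0 ≤ L f := fun f => Finset.prod_nonneg fun i _ => hl _
  have hL1 : ∑ f, L f = 1 := sum_prod_one n l hl1
  have hS0 : ∀ f, 0 ≤ S f := fun f => Finset.prod_nonneg fun i _ => hs0 _
  have hS1 : ∑ f, S f = 1 := sum_prod_one n s hs1
  have hRS : ∀ f, tpow n ρ f f = (S f : ℂ) := by
    intro f
    simp only [tpow, Matrix.of_apply, hsρ, S]
    push_cast
    rfl
  have hmat := mat_core E V L hE hE1 hV hL hL1 (by
    rw [← hR, hdual, hout, hPP, hPtr])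
  -- overlap with the diagonal state
  have hσ : ∑ f, S f * (E f f).re = (1 / 2) ^ m := by
    let σ : Matrix (Fin n → Fin 2) (Fin n → Fin 2) ℂ := diagonal fun f => (S f : ℂ)
    have hσtr : σ.trace = 1 := by
      simp only [σ, Matrix.trace_diagonal]
      exact_mod_cast hS1
    have hσd : IsDensityMatrix σ :=
      ⟨Matrix.posSemidef_diagonal_iff.mpr fun f => by exact_mod_cast hS0 f, hσtr⟩
    have hdg := hNC σ hσd (Matrix.isDiag_diagonal _)
    have h1 : (E * σ).trace = (1 / 2) ^ m := by
      rw [hdual, ← hdg.diagonal_diag]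
      simp only [Matrix.trace, Matrix.diag, Matrix.mul_diagonal, hPd]
      rw [← Finset.mul_sum]
      have := htrK σ
      rw [hσtr] at this
      simp only [Matrix.trace, Matrix.diag] at this
      rw [this, mul_one]
    simp only [σ, Matrix.trace, Matrix.diag, Matrix.mul_diagonal] at h1
    have h2 := congrArg Complex.re h1
    have h3 : (((1:ℂ) / 2) ^ m).re = (1 / 2 : ℝ) ^ m := by
      rw [show ((1:ℂ) / 2) ^ m = (((1 / 2 : ℝ) ^ m : ℝ) : ℂ) by push_cast; rfl, Complex.ofReal_re]
    rw [h3, Complex.re_sum] at h2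
    rw [← h2]
    refine Finset.sum_congr rfl fun f _ => ?_
    simp [mul_comm]
  have hfin := real_core (fun x i => ‖V x i‖ ^ 2) L S m (fun _ _ => by positivity) hL hL1
    (by
      intro i
      have := congrFun (congrFun hV i) i
      rw [Matrix.mul_apply, Matrix.one_apply_eq] at this
      simp only [Matrix.conjTranspose_apply, RCLike.star_def, Complex.conj_mul'] at this
      exact_mod_cast this)
    (by
      intro x
      have := hRS x
      rw [hR, Matrix.mul_apply] at this
      have h2 : ∀ i, (V * diagonal (fun f => (L f : ℂ))) x i * Vᴴ i x =
          ((‖V x i‖ ^ 2 * L i : ℝ) : ℂ) := by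
        intro i
        rw [Matrix.mul_diagonal, Matrix.conjTranspose_apply, RCLike.star_def, mul_right_comm,
          Complex.mul_conj']
        push_cast
        rfl
      simp_rw [h2] at this
      exact_mod_cast this.symm)
    (by
      rw [← hσ]
      exact Finset.sum_le_sum fun x _ => mul_le_mul_of_nonneg_left (hmat x) (hS0 x))
  have eS : shannon2 S = n * shannon2 s := shannon_prod n s hs1
  have eL : shannon2 L = n * shannon2 l := shannon_prod n l hl1
  rw [hCr, mul_sub, ← eS, ← eL]
  exact hfin
end

section
/- There exist a dimension d, a non-coherence-generating channel Λ on d×d density matrices, and a d×d density matrix ρ such that C_f(Λ(ρ)) > C_f(ρ). In other words, the coherence of formation is not monotonically decreasing under non-coherence-generating channels. -/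
open Matrix BigOperators Kronecker ComplexOrder

/-- rank-one Kraus operators -/
noncomputable def kb (w : Fin 8 → Fin 4 → ℂ) (u : Fin 8 → Fin 4 → ℂ) (i : Fin 8) :
    Matrix (Fin 4) (Fin 4) ℂ := Matrix.of fun a b => w i a * u i b

noncomputable def wv : Fin 8 → Fin 4 → ℂ :=
  ![![7/9,0,4/9,4/9], ![0,7/9,4/9,-4/9], ![7/9,0,4/9,4/9], ![0,7/9,4/9,-4/9],
    ![-4/9,-4/9,7/9,0], ![-4/9,4/9,0,7/9], ![-4/9,-4/9,7/9,0], ![-4/9,4/9,0,7/9]]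

noncomputable def uv : Fin 8 → Fin 4 → ℂ :=
  ![![1/2,1/2,0,0], ![1/2,1/2,0,0], ![0,0,1/2,1/2], ![0,0,1/2,1/2],
    ![1/2,-1/2,0,0], ![1/2,-1/2,0,0], ![0,0,1/2,-1/2], ![0,0,1/2,-1/2]]

noncomputable def rhoIn : Matrix (Fin 4) (Fin 4) ℂ :=
  !![1/2,1/2,0,0; 1/2,1/2,0,0; 0,0,0,0; 0,0,0,0]

noncomputable def sigOut : Matrix (Fin 4) (Fin 4) ℂ :=
  !![49/162,0,28/162,28/162; 0,49/162,28/162,-28/162;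
     28/162,28/162,32/162,0; 28/162,-28/162,0,32/162]

lemma wv_star (i : Fin 8) (a : Fin 4) : star (wv i a) = wv i a := by
  fin_cases i <;> fin_cases a <;> simp [wv]

lemma uv_star (i : Fin 8) (a : Fin 4) : star (uv i a) = uv i a := by
  fin_cases i <;> fin_cases a <;> simp [uv]

lemma wv_norm (i : Fin 8) : ∑ a, wv i a * wv i a = 1 := by
  fin_cases i <;> simp [wv, Fin.sum_univ_four] <;> norm_num

lemma kraus_complete : ∑ i, (kb wv uv i)ᴴ * kb wv uv i = 1 := by
  have h : ∀ i a b, ((kb wv uv i)ᴴ * kb wv uv i) a b = uv i a * uv i b := by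
    intro i a b
    have : ((kb wv uv i)ᴴ * kb wv uv i) a b = (∑ c, wv i c * wv i c) * (uv i a * uv i b) := by
      simp only [Matrix.mul_apply, Matrix.conjTranspose_apply, kb, Matrix.of_apply, star_mul',
        wv_star, uv_star, Finset.sum_mul]
      exact Finset.sum_congr rfl fun c _ => by ring
    rw [this, wv_norm, one_mul]
  ext a b
  rw [Matrix.sum_apply]
  simp only [h]
  fin_cases a <;> fin_cases b <;>
    simp [uv, Fin.sum_univ_eight] <;> norm_num

lemma kraus_entry (σ : Matrix (Fin 4) (Fin 4) ℂ) (a b : Fin 4) :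
    krausApply (kb wv uv) σ a b =
      ∑ i, wv i a * wv i b * (∑ d, ∑ c, uv i c * σ c d * uv i d) := by
  rw [krausApply, Matrix.sum_apply]
  refine Finset.sum_congr rfl fun i _ => ?_
  simp only [Matrix.mul_apply, Matrix.conjTranspose_apply, kb, Matrix.of_apply, star_mul',
        wv_star, uv_star, Finset.sum_mul, Finset.mul_sum]
  exact Finset.sum_congr rfl fun c _ => Finset.sum_congr rfl fun c _ => by ring

lemma diag_weight (d : Fin 4 → ℂ) (i : Fin 8) :
    (∑ x, ∑ c, uv i c * Matrix.diagonal d c x * uv i x) =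
      (![(d 0 + d 1)/4, (d 0 + d 1)/4, (d 2 + d 3)/4, (d 2 + d 3)/4,
        (d 0 + d 1)/4, (d 0 + d 1)/4, (d 2 + d 3)/4, (d 2 + d 3)/4] : Fin 8 → ℂ) i := by
  have : ∀ x, ∑ c, uv i c * Matrix.diagonal d c x * uv i x = uv i x * d x * uv i x := by
    intro x
    rw [Finset.sum_eq_single x]
    · simp
    · intro c _ h; simp [Matrix.diagonal_apply_ne _ h]
    · simp
  simp only [this]
  fin_cases i <;> simp [uv, Fin.sum_univ_four] <;> ring

lemma rho_weight (i : Fin 8) :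
    (∑ x, ∑ c, uv i c * rhoIn c x * uv i x) =
      (![1/2, 1/2, 0, 0, 0, 0, 0, 0] : Fin 8 → ℂ) i := by
  fin_cases i <;> simp [uv, rhoIn, Fin.sum_univ_four] <;> norm_num

lemma kraus_diag (σ : Matrix (Fin 4) (Fin 4) ℂ) (h : σ.IsDiag) :
    (krausApply (kb wv uv) σ).IsDiag := by
  have hs : σ = Matrix.diagonal σ.diag := h.diagonal_diag.symm
  intro a b hab
  rw [hs, kraus_entry]
  simp only [diag_weight]
  generalize σ.diag = d
  fin_cases a <;> fin_cases b <;> first | exact absurd rfl hab |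
    (simp [wv, Fin.sum_univ_eight]; try ring)

lemma kraus_out : krausApply (kb wv uv) rhoIn = sigOut := by
  ext a b
  rw [kraus_entry]
  simp only [rho_weight]
  fin_cases a <;> fin_cases b <;>
    simp [wv, sigOut, Fin.sum_univ_eight] <;> norm_num

noncomputable def plusV : Fin 4 → ℂ := ![((√2 / 2 : ℝ) : ℂ), ((√2 / 2 : ℝ) : ℂ), 0, 0]

lemma sq2 : ((√2 : ℝ) : ℂ) * ((√2 : ℝ) : ℂ) = 2 := by
  rw [← Complex.ofReal_mul, Real.mul_self_sqrt (by norm_num)]; norm_num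

lemma rho_eq : rhoIn = Matrix.vecMulVec plusV (star plusV) := by
  ext a b
  fin_cases a <;> fin_cases b <;>
    simp [rhoIn, plusV, Matrix.vecMulVec_apply] <;> linear_combination (-1/4) * sq2

lemma rho_density : IsDensityMatrix rhoIn := by
  refine ⟨?_, ?_⟩
  · rw [rho_eq]; exact Matrix.posSemidef_vecMulVec_self_star _
  · simp [rhoIn, Matrix.trace, Fin.sum_univ_succ]; norm_num

lemma shannon_nonneg (p : Fin 4 → ℝ) (h0 : ∀ i, 0 ≤ p i) (h1 : ∑ i, p i = 1) :
    0 ≤ shannon2 p := by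
  unfold shannon2
  rw [← Finset.sum_neg_distrib]
  refine Finset.sum_nonneg fun i _ => ?_
  have hle : p i ≤ 1 := by
    rw [← h1]; exact Finset.single_le_sum (fun j _ => h0 j) (Finset.mem_univ i)
  have : Real.logb 2 (p i) ≤ 0 := Real.logb_nonpos (by norm_num) (h0 i) hle
  nlinarith [h0 i]

lemma plus_norm (i : Fin 4) : ‖plusV i‖ ^ 2 = (![1/2,1/2,0,0] : Fin 4 → ℝ) i := by
  have h : ‖((√2 / 2 : ℝ) : ℂ)‖ ^ 2 = 1/2 := by
    rw [Complex.norm_real, Real.norm_eq_abs, sq_abs, div_pow, Real.sq_sqrt (by norm_num)]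
    norm_num
  fin_cases i
  · simpa [plusV] using h
  · simpa [plusV] using h
  · simp [plusV]
  · simp [plusV]

lemma Cf_rho : Cf rhoIn ≤ 1 := by
  unfold Cf
  apply csInf_le
  · refine ⟨0, ?_⟩
    rintro x ⟨m, p, ψ, hp, -, hn, -, rfl⟩
    exact Finset.sum_nonneg fun i _ => mul_nonneg (hp i).le
      (shannon_nonneg _ (fun j => by positivity) (hn i))
  · refine ⟨1, fun _ => 1, fun _ => plusV, fun _ => one_pos, by simp, ?_, ?_, ?_⟩
    · intro _
      simp only [plus_norm]
      simp [Fin.sum_univ_succ]; norm_num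
    · simp [rho_eq]
    · simp only [plus_norm]
      have : Real.logb 2 2⁻¹ = -1 := by
        rw [Real.logb_inv, Real.logb_self_eq_one (by norm_num)]
      simp [shannon2, Fin.sum_univ_succ, this]; norm_num

lemma tangent (p : ℝ) (h : 0 ≤ p) : p * Real.log p ≤ p * (2 * p - 1 - Real.log 2) := by
  rcases h.eq_or_lt with rfl | h
  · simp
  · apply mul_le_mul_of_nonneg_left _ h.le
    have := Real.log_le_sub_one_of_pos (show 0 < 2 * p by positivity)
    rw [Real.log_mul (by norm_num) h.ne'] at this
    linarith

lemma shannon_lower (p : Fin 4 → ℝ) (h0 : ∀ i, 0 ≤ p i) (h1 : ∑ i, p i = 1)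
    (h2 : ∑ i, p i ^ 2 ≤ 9/20) : 11/10 ≤ shannon2 p := by
  have hl : 0 < Real.log 2 := Real.log_pos (by norm_num)
  have hl1 : Real.log 2 < 1 := by linarith [Real.log_two_lt_d9]
  have hs : shannon2 p = (-∑ i, p i * Real.log (p i)) / Real.log 2 := by
    simp [shannon2, Real.logb, Finset.sum_div, mul_div_assoc, neg_div]
  rw [hs, le_div_iff₀ hl]
  have : ∑ i, p i * Real.log (p i) ≤ ∑ i, p i * (2 * p i - 1 - Real.log 2) :=
    Finset.sum_le_sum fun i _ => tangent _ (h0 i)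
  have e : ∑ i, p i * (2 * p i - 1 - Real.log 2)
      = 2 * ∑ i, p i ^ 2 - (1 + Real.log 2) * ∑ i, p i := by
    rw [Finset.mul_sum, Finset.mul_sum, ← Finset.sum_sub_distrib]
    exact Finset.sum_congr rfl fun i _ => by ring
  rw [e, h1] at this
  linarith

/-- a vector in the range has spread-out populations -/
lemma range_bound (ψ : Fin 4 → ℂ) (hn : ∑ j, ‖ψ j‖ ^ 2 = 1)
    (ha : 7 * ψ 2 = 4 * (ψ 0 + ψ 1)) (hb : 7 * ψ 3 = 4 * (ψ 0 - ψ 1)) :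
    ∑ j, (‖ψ j‖ ^ 2) ^ 2 ≤ 9/20 := by
  have a2 : ψ 2 = 4/7 * (ψ 0 + ψ 1) := by linear_combination ha / 7
  have b2 : ψ 3 = 4/7 * (ψ 0 - ψ 1) := by linear_combination hb / 7
  have hre : (4/7 : ℂ) = ((4/7 : ℝ) : ℂ) := by norm_num
  rw [hre] at a2 b2
  simp only [Fin.sum_univ_four, a2, b2, ← Complex.normSq_eq_norm_sq, Complex.normSq_mul,
    Complex.normSq_ofReal] at hn ⊢
  simp only [Complex.normSq_apply, Complex.add_re, Complex.add_im, Complex.sub_re,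
    Complex.sub_im] at hn ⊢
  generalize (ψ 0).re = a at *
  generalize (ψ 0).im = b at *
  generalize (ψ 1).re = c at *
  generalize (ψ 1).im = d at *
  have hpq : (a*a+b*b) + (c*c+d*d) = 49/81 := by linarith
  have hcs : (a*c+b*d)^2 ≤ (a*a+b*b)*(c*c+d*d) := by nlinarith [sq_nonneg (a*d-b*c)]
  have e1 : (a+c)*(a+c)+(b+d)*(b+d) = 49/81 + 2*(a*c+b*d) := by linarith
  have e2 : (a-c)*(a-c)+(b-d)*(b-d) = 49/81 - 2*(a*c+b*d) := by linarith
  rw [e1, e2]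
  have hp : 0 ≤ a*a+b*b := add_nonneg (mul_self_nonneg a) (mul_self_nonneg b)
  have hq : 0 ≤ c*c+d*d := add_nonneg (mul_self_nonneg c) (mul_self_nonneg d)
  generalize a*c+b*d = r at *
  generalize a*a+b*b = p at *
  generalize c*c+d*d = q at *
  have : q = 49/81 - p := by linarith
  subst this
  nlinarith [mul_nonneg hp hq]

/-- vectors in the kernel are orthogonal to every member of a decomposition -/
lemma ker_orth {m : ℕ} (p : Fin m → ℝ) (ψ : Fin m → Fin 4 → ℂ) (hp : ∀ i, 0 < p i)
    (hσ : sigOut = ∑ i, (p i : ℂ) • Matrix.vecMulVec (ψ i) (star (ψ i)))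
    (v : Fin 4 → ℂ) (hv : star v ⬝ᵥ sigOut *ᵥ v = 0) (i : Fin m) : star v ⬝ᵥ ψ i = 0 := by
  have key : star v ⬝ᵥ sigOut *ᵥ v = ((∑ i, p i * ‖star v ⬝ᵥ ψ i‖ ^ 2 : ℝ) : ℂ) := by
    rw [hσ, Matrix.sum_mulVec, dotProduct_sum]
    push_cast
    refine Finset.sum_congr rfl fun i _ => ?_
    rw [Matrix.smul_mulVec, dotProduct_smul, Matrix.vecMulVec_mulVec, ← Complex.mul_conj']
    have : (starRingEnd ℂ) (star v ⬝ᵥ ψ i) = star (ψ i) ⬝ᵥ v := by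
      rw [starRingEnd_apply, ← Matrix.star_dotProduct_star]; simp [dotProduct_comm]
    rw [this]
    simp [dotProduct_smul, mul_comm]
  rw [hv] at key
  have k0 : ∑ i, p i * ‖star v ⬝ᵥ ψ i‖ ^ 2 = 0 := by exact_mod_cast key.symm
  rw [Finset.sum_eq_zero_iff_of_nonneg (fun i _ => by have := hp i; positivity)] at k0
  have := k0 i (Finset.mem_univ i)
  have h3 := (hp i).ne'
  simpa [h3] using this

lemma Cf_sig : 11/10 ≤ Cf sigOut := by
  unfold Cf
  apply le_csInf
  · refine ⟨_, 2, fun _ => 1/2, ![wv 0, wv 1], fun _ => by norm_num, by simp, ?_, ?_, rfl⟩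
    · intro i
      fin_cases i <;> simp [wv, Fin.sum_univ_succ] <;> norm_num
    · ext a b
      simp only [Matrix.sum_apply, Fin.sum_univ_two, Matrix.smul_apply, Matrix.vecMulVec_apply,
        Pi.star_apply, Matrix.cons_val_zero, Matrix.cons_val_one, wv_star]
      fin_cases a <;> fin_cases b <;> simp [sigOut, wv] <;> norm_num
  · rintro x ⟨m, p, ψ, hp, hs, hn, hσ, rfl⟩
    have h : ∀ i, 11/10 ≤ shannon2 (fun j => ‖ψ i j‖ ^ 2) := by
      intro i
      apply shannon_lower _ (fun j => by positivity) (hn i)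
      have h1 := ker_orth p ψ hp hσ ![-4,-4,7,0]
        (by simp [sigOut, dotProduct, Matrix.mulVec, Fin.sum_univ_succ]; try norm_num) i
      have h2 := ker_orth p ψ hp hσ ![-4,4,0,7]
        (by simp [sigOut, dotProduct, Matrix.mulVec, Fin.sum_univ_succ]; try norm_num) i
      have c4 : (starRingEnd ℂ) 4 = 4 := map_ofNat _ 4
      have c7 : (starRingEnd ℂ) 7 = 7 := map_ofNat _ 7
      simp [dotProduct, Fin.sum_univ_four] at h1 h2
      rw [c4, c7] at h1 h2
      exact range_bound _ (hn i) (by linear_combination h1) (by linear_combination h2)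
    calc (11/10 : ℝ) = ∑ i, p i * (11/10) := by rw [← Finset.sum_mul, hs, one_mul]
      _ ≤ _ := Finset.sum_le_sum fun i _ => mul_le_mul_of_nonneg_left (h i) (hp i).le

/-- **Theorem 3.** The coherence of formation can be increased by some
non-coherence-generating channel: there exist a dimension `d`, an NC channel, and a
density matrix `ρ` with `C_f(Λ(ρ)) > C_f(ρ)`. -/
theorem Cf_not_monotone_under_NC :
    ∃ (d N : ℕ) (K : Fin N → Matrix (Fin d) (Fin d) ℂ)
      (ρ : Matrix (Fin d) (Fin d) ℂ),
      (∑ i, (K i)ᴴ * K i = 1) ∧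
      (∀ σ : Matrix (Fin d) (Fin d) ℂ,
        IsDensityMatrix σ → σ.IsDiag → (krausApply K σ).IsDiag) ∧
      IsDensityMatrix ρ ∧ Cf ρ < Cf (krausApply K ρ) := by
  refine ⟨4, 8, kb wv uv, rhoIn, kraus_complete, fun σ _ h => kraus_diag σ h, rho_density, ?_⟩
  rw [kraus_out]
  linarith [Cf_rho, Cf_sig]
end

section
/- Let E₁ = (1/2)[[1, 0], [-1, √2]], E₂ = (1/2)[[1, √2], [1, 0]], let Λ_ex be the qubit channel with Kraus operators E₁, E₂, and let id₂ be the identity qubit channel. Then the coherence-increasing powers with respect to the coherence of formation satisfy P_{C_f}(id₂) = 0 and P_{C_f}(Λ_ex) = 0, while P_{C_f}(id₂ ⊗ Λ_ex) > 0, where id₂ ⊗ Λ_ex is the two-qubit channel with Kraus operators I₂⊗E₁ and I₂⊗E₂. -/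
open Matrix BigOperators Kronecker ComplexOrder

/-- Coherence-increasing power of a channel `Λ` with respect to a coherence measure `C`:
the supremum of `C (Λ ρ) - C ρ` over density matrices `ρ`. -/
noncomputable def cohPower {n : Type*} [Fintype n]
    (C : Matrix n n ℂ → ℝ) (Λ : Matrix n n ℂ → Matrix n n ℂ) : ℝ :=
  sSup { x : ℝ | ∃ ρ, IsDensityMatrix ρ ∧ x = C (Λ ρ) - C ρ }

/-- The Kraus operator `E₁ = (1/2)[[1, 0], [-1, √2]]` from the paper's example. -/
noncomputable def E1ex : Matrix (Fin 2) (Fin 2) ℂ :=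
  (1 / 2 : ℂ) • !![1, 0; -1, (Real.sqrt 2 : ℂ)]

/-- The Kraus operator `E₂ = (1/2)[[1, √2], [1, 0]]` from the paper's example. -/
noncomputable def E2ex : Matrix (Fin 2) (Fin 2) ℂ :=
  (1 / 2 : ℂ) • !![1, (Real.sqrt 2 : ℂ); 1, 0]

lemma shannon2_nonneg' {n : Type*} [Fintype n] (f : n → ℂ) (h : ∑ j, ‖f j‖ ^ 2 = 1) :
    0 ≤ shannon2 (fun j => ‖f j‖ ^ 2) := by
  unfold shannon2
  rw [neg_nonneg]
  apply Finset.sum_nonpos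
  intro i _
  have h1 : ‖f i‖ ^ 2 ≤ 1 := by
    rw [← h]
    exact Finset.single_le_sum (f := fun j => ‖f j‖ ^ 2) (fun j _ => by positivity)
      (Finset.mem_univ i)
  exact mul_nonpos_of_nonneg_of_nonpos (by positivity)
    (Real.logb_nonpos (by norm_num) (by positivity) h1)

lemma shannon2_le' {n : Type*} [Fintype n] (f : n → ℂ) :
    shannon2 (fun j => ‖f j‖ ^ 2) ≤ Fintype.card n * (1 / Real.log 2) := by
  unfold shannon2
  rw [← Finset.sum_neg_distrib]
  calc ∑ i, -(‖f i‖ ^ 2 * Real.logb 2 (‖f i‖ ^ 2)) ≤ ∑ i : n, 1 / Real.log 2 := by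
        apply Finset.sum_le_sum
        intro i _
        have hl : 0 < Real.log 2 := Real.log_pos (by norm_num)
        unfold Real.logb
        rw [← mul_div_assoc, ← neg_div]
        apply div_le_div_of_nonneg_right _ hl.le
        set x := ‖f i‖ ^ 2 with hx
        have hx0 : 0 ≤ x := by positivity
        rcases hx0.eq_or_lt with h0 | h0
        · rw [← h0]; simp
        · have := Real.one_sub_inv_le_log_of_pos h0
          have h2 : x * (1 - x⁻¹) ≤ x * Real.log x := mul_le_mul_of_nonneg_left this hx0
          have h3 : x * (1 - x⁻¹) = x - 1 := by field_simp
          linarith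
    _ = _ := by simp

def CfSet {n : Type*} [Fintype n] (ρ : Matrix n n ℂ) : Set ℝ :=
  { x : ℝ | ∃ (m : ℕ) (p : Fin m → ℝ) (ψ : Fin m → n → ℂ),
    (∀ i, 0 < p i) ∧ (∑ i, p i = 1) ∧ (∀ i, ∑ j, ‖ψ i j‖ ^ 2 = 1) ∧
    ρ = ∑ i, (p i : ℂ) • Matrix.vecMulVec (ψ i) (star (ψ i)) ∧
    x = ∑ i, p i * shannon2 (fun j => ‖ψ i j‖ ^ 2) }

lemma Cf_eq {n : Type*} [Fintype n] (ρ : Matrix n n ℂ) : Cf ρ = sInf (CfSet ρ) := rfl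

lemma CfSet_nonneg {n : Type*} [Fintype n] (ρ : Matrix n n ℂ) : ∀ x ∈ CfSet ρ, 0 ≤ x := by
  rintro x ⟨m, p, ψ, hp, hs, hn, -, rfl⟩
  exact Finset.sum_nonneg fun i _ => mul_nonneg (hp i).le (shannon2_nonneg' _ (hn i))

lemma CfSet_le {n : Type*} [Fintype n] (ρ : Matrix n n ℂ) :
    ∀ x ∈ CfSet ρ, x ≤ Fintype.card n * (1 / Real.log 2) := by
  rintro x ⟨m, p, ψ, hp, hs, hn, -, rfl⟩
  calc ∑ i, p i * shannon2 (fun j => ‖ψ i j‖ ^ 2)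
      ≤ ∑ i, p i * (Fintype.card n * (1 / Real.log 2)) :=
        Finset.sum_le_sum fun i _ => mul_le_mul_of_nonneg_left (shannon2_le' _) (hp i).le
    _ = _ := by rw [← Finset.sum_mul, hs, one_mul]

lemma Cf_nonneg {n : Type*} [Fintype n] (ρ : Matrix n n ℂ) : 0 ≤ Cf ρ :=
  Real.sInf_nonneg (CfSet_nonneg ρ)

lemma Cf_le_card {n : Type*} [Fintype n] (ρ : Matrix n n ℂ) :
    Cf ρ ≤ Fintype.card n * (1 / Real.log 2) := by
  rw [Cf_eq]
  rcases (CfSet ρ).eq_empty_or_nonempty with h | ⟨x, hx⟩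
  · rw [h, Real.sInf_empty]
    have hl : 0 < Real.log 2 := Real.log_pos (by norm_num)
    positivity
  · exact (csInf_le ⟨0, CfSet_nonneg ρ⟩ hx).trans (CfSet_le ρ x hx)

lemma mem_CfSet {n ι : Type*} [Fintype n] [Fintype ι] (ρ : Matrix n n ℂ) (p : ι → ℝ)
    (ψ : ι → n → ℂ) (hp : ∀ i, 0 ≤ p i) (hs : ∑ i, p i = 1)
    (hn : ∀ i, ∑ j, ‖ψ i j‖ ^ 2 = 1)
    (hρ : ρ = ∑ i, (p i : ℂ) • Matrix.vecMulVec (ψ i) (star (ψ i))) :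
    ∑ i, p i * shannon2 (fun j => ‖ψ i j‖ ^ 2) ∈ CfSet ρ := by
  classical
  let e := (Fintype.equivFin {i // 0 < p i}).symm
  have hz : ∀ i, ¬ 0 < p i → p i = 0 := fun i h => le_antisymm (not_lt.mp h) (hp i)
  have key : ∀ {M : Type _} [AddCommMonoid M] (f : ι → M), (∀ i, ¬ 0 < p i → f i = 0) →
      ∑ k, f (e k).1 = ∑ i, f i := by
    intro M _ f hf
    rw [Equiv.sum_comp e (fun i => f i.1),
      ← Finset.sum_subtype (Finset.univ.filter fun i => 0 < p i) (by simp) f]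
    apply Finset.sum_filter_of_ne
    intro i _ h
    by_contra h'
    exact h (hf i h')
  have key2 : ∀ (f : ι → Matrix n n ℂ), (∀ i, ¬ 0 < p i → f i = 0) →
      ∑ k, f (e k).1 = ∑ i, f i := by
    intro f hf
    rw [Equiv.sum_comp e (fun i => f i.1),
      ← Finset.sum_subtype (Finset.univ.filter fun i => 0 < p i) (by simp) f]
    apply Finset.sum_filter_of_ne
    intro i _ h
    by_contra h'
    exact h (hf i h')
  refine ⟨_, fun k => p (e k).1, fun k => ψ (e k).1, fun k => (e k).2, ?_, fun k => hn _, ?_, ?_⟩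
  · rw [key p hz, hs]
  · rw [key2 (fun i => (p i : ℂ) • Matrix.vecMulVec (ψ i) (star (ψ i))), hρ]
    intro i hi
    simp [hz i hi]
  · rw [key (fun i => p i * shannon2 (fun j => ‖ψ i j‖ ^ 2))]
    intro i hi
    simp [hz i hi]

lemma binEntropy_mono' {x y : ℝ} (hx0 : 0 ≤ x) (hx1 : x ≤ 1) (hy0 : 0 ≤ y) (hy1 : y ≤ 1)
    (h : x * (1 - x) ≤ y * (1 - y)) : Real.binEntropy x ≤ Real.binEntropy y := by
  have red : ∀ z : ℝ, 0 ≤ z → z ≤ 1 → ∃ w, 0 ≤ w ∧ w ≤ 2⁻¹ ∧ w * (1 - w) = z * (1 - z) ∧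
      Real.binEntropy w = Real.binEntropy z := by
    intro z h0 h1
    rcases le_total z 2⁻¹ with h | h
    · exact ⟨z, h0, h, rfl, rfl⟩
    · refine ⟨1 - z, by linarith, by norm_num at h ⊢; linarith, by ring, Real.binEntropy_one_sub z⟩
  obtain ⟨a, ha0, ha1, ha, hea⟩ := red x hx0 hx1
  obtain ⟨b, hb0, hb1, hb, heb⟩ := red y hy0 hy1
  rw [← hea, ← heb]
  apply Real.binEntropy_strictMonoOn.monotoneOn ⟨ha0, ha1⟩ ⟨hb0, hb1⟩
  norm_num at ha1 hb1
  by_contra hc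
  push Not at hc
  nlinarith

lemma shannon2_qubit (f : Fin 2 → ℂ) (h : ∑ j, ‖f j‖ ^ 2 = 1) :
    shannon2 (fun j => ‖f j‖ ^ 2) = Real.binEntropy (‖f 0‖ ^ 2) / Real.log 2 := by
  rw [Fin.sum_univ_two] at h
  have h1 : ‖f 1‖ ^ 2 = 1 - ‖f 0‖ ^ 2 := by linarith
  unfold shannon2
  simp only [Fin.sum_univ_two, h1]
  rw [Real.binEntropy_eq_negMulLog_add_negMulLog_one_sub]
  unfold Real.logb Real.negMulLog
  ring

lemma shannon2_qubit_mono (f g : Fin 2 → ℂ) (hf : ∑ j, ‖f j‖ ^ 2 = 1) (hg : ∑ j, ‖g j‖ ^ 2 = 1)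
    (h : ‖f 0‖ ^ 2 * ‖f 1‖ ^ 2 ≤ ‖g 0‖ ^ 2 * ‖g 1‖ ^ 2) :
    shannon2 (fun j => ‖f j‖ ^ 2) ≤ shannon2 (fun j => ‖g j‖ ^ 2) := by
  rw [shannon2_qubit f hf, shannon2_qubit g hg]
  rw [Fin.sum_univ_two] at hf hg
  have hl : 0 < Real.log 2 := Real.log_pos (by norm_num)
  apply div_le_div_of_nonneg_right _ hl.le
  have h1 := sq_nonneg ‖f 0‖
  have h2 := sq_nonneg ‖f 1‖
  have h3 := sq_nonneg ‖g 0‖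
  have h4 := sq_nonneg ‖g 1‖
  apply binEntropy_mono' h1 (by linarith) h3 (by linarith)
  rw [show 1 - ‖f 0‖ ^ 2 = ‖f 1‖ ^ 2 by linarith, show 1 - ‖g 0‖ ^ 2 = ‖g 1‖ ^ 2 by linarith]
  exact h

lemma qubit_decomp (σ : Matrix (Fin 2) (Fin 2) ℂ) (hσ : IsDensityMatrix σ) :
    ∃ (w : Fin 2 → ℝ) (φ : Fin 2 → Fin 2 → ℂ), (∀ k, 0 ≤ w k) ∧ ∑ k, w k = 1 ∧
      (∀ k, ∑ j, ‖φ k j‖ ^ 2 = 1) ∧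
      σ = ∑ k, (w k : ℂ) • Matrix.vecMulVec (φ k) (star (φ k)) ∧
      ∀ k, ‖φ k 0‖ ^ 2 * ‖φ k 1‖ ^ 2 = ‖σ 0 1‖ ^ 2 := by
  obtain ⟨hpos, htr⟩ := hσ
  have hherm := hpos.isHermitian
  have h10 : σ 1 0 = star (σ 0 1) := (hherm.apply 1 0).symm
  have h00 : ((σ 0 0).re : ℂ) = σ 0 0 := hherm.coe_re_apply_self 0
  have hdet := hpos.det_nonneg
  rw [Matrix.det_fin_two, h10] at hdet
  rw [Matrix.trace_fin_two] at htr
  set a := (σ 0 0).re with ha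
  have h11 : σ 1 1 = ((1 - a : ℝ) : ℂ) := by push_cast; rw [h00]; linear_combination htr
  set b := σ 0 1 with hb
  have hbb : b * star b = ((‖b‖ ^ 2 : ℝ) : ℂ) := by
    rw [Complex.star_def, Complex.mul_conj, Complex.normSq_eq_norm_sq]
  rw [← h00, h11, hbb, ← Complex.ofReal_mul, ← Complex.ofReal_sub] at hdet
  have hd : ‖b‖ ^ 2 ≤ a * (1 - a) := by
    have := Complex.zero_le_real.mp hdet
    linarith
  obtain ⟨u, hu, hbu⟩ : ∃ u : ℂ, ‖u‖ = 1 ∧ b = ‖b‖ * u :=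
    ⟨Complex.exp (Complex.arg b * Complex.I), Complex.norm_exp_ofReal_mul_I _,
      (Complex.norm_mul_exp_arg_mul_I b).symm⟩
  set t := ‖b‖ with ht
  have ht0 : 0 ≤ t := norm_nonneg _
  have hs0 : 0 ≤ 1 - 4 * t ^ 2 := by nlinarith [sq_nonneg (2 * a - 1)]
  obtain ⟨s, hs, hss⟩ : ∃ s : ℝ, 0 ≤ s ∧ s ^ 2 = 1 - 4 * t ^ 2 :=
    ⟨_, Real.sqrt_nonneg _, Real.sq_sqrt hs0⟩
  have hs1 : s ≤ 1 := by nlinarith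
  obtain ⟨c, hc, hcc⟩ : ∃ c : ℝ, 0 ≤ c ∧ c ^ 2 = (1 + s) / 2 :=
    ⟨_, Real.sqrt_nonneg _, Real.sq_sqrt (by linarith)⟩
  obtain ⟨d, hdd, hdd2⟩ : ∃ d : ℝ, 0 ≤ d ∧ d ^ 2 = (1 - s) / 2 :=
    ⟨_, Real.sqrt_nonneg _, Real.sq_sqrt (by linarith)⟩
  have hcd : c * d = t := by
    have : (c * d) ^ 2 = t ^ 2 := by rw [mul_pow, hcc, hdd2]; linarith
    exact (pow_left_inj₀ (by positivity) ht0 (by norm_num)).mp this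
  have hseg : a ∈ segment ℝ (d ^ 2) (c ^ 2) := by
    rw [segment_eq_Icc (by linarith), hcc, hdd2]
    have : |2 * a - 1| ≤ s := abs_le_of_sq_le_sq (by nlinarith) hs
    rw [abs_le] at this
    constructor <;> linarith
  obtain ⟨w0, w1, hw0, hw1, hw, hwa⟩ := hseg
  simp only [smul_eq_mul] at hwa
  have huu : u * star u = 1 := by
    rw [Complex.star_def, Complex.mul_conj, Complex.normSq_eq_norm_sq, hu]; simp
  have hcdsq : c ^ 2 + d ^ 2 = 1 := by rw [hcc, hdd2]; ring
  refine ⟨![w0, w1], ![![d * u, c], ![c * u, d]], ?_, ?_, ?_, ?_, ?_⟩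
  · intro k; fin_cases k <;> simp [hw0, hw1]
  · simp [hw]
  · intro k; fin_cases k <;>
      simp [Fin.sum_univ_two, hu, abs_of_nonneg hc, abs_of_nonneg hdd] <;> linarith
  · have hwaC : (w0 : ℂ) * (d : ℂ) ^ 2 + w1 * (c : ℂ) ^ 2 = a := by exact_mod_cast hwa
    have hwC : (w0 : ℂ) + w1 = 1 := by exact_mod_cast hw
    have hcdC : (c : ℂ) * d = t := by exact_mod_cast hcd
    have hsqC : (c : ℂ) ^ 2 + (d : ℂ) ^ 2 = 1 := by exact_mod_cast hcdsq
    have huu' : u * (starRingEnd ℂ) u = 1 := huu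
    ext i j
    simp only [Fin.sum_univ_two, Matrix.add_apply, Matrix.smul_apply, Matrix.vecMulVec_apply,
      Pi.star_apply]
    fin_cases i <;> fin_cases j <;> simp
    · rw [← h00]
      linear_combination (-1 : ℂ) * hwaC - (w0 * d ^ 2 + w1 * c ^ 2) * huu'
    · rw [← hb, hbu]
      linear_combination (-t * u) * hwC - (w0 + w1) * u * hcdC
    · rw [h10, hbu]
      simp only [star_mul', Complex.star_def, Complex.conj_ofReal]
      linear_combination (-t * (starRingEnd ℂ) u) * hwC - (w0 + w1) * (starRingEnd ℂ) u * hcdC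
    · rw [h11]
      push_cast
      linear_combination hwaC - (w0 + w1) * hsqC - hwC
  · intro k; fin_cases k <;>
      simp [hu, abs_of_nonneg hc, abs_of_nonneg hdd, ← hcd] <;> ring

lemma isDensity_pure {n : Type*} [Fintype n] (ψ : n → ℂ) (h : ∑ j, ‖ψ j‖ ^ 2 = 1) :
    IsDensityMatrix (Matrix.vecMulVec ψ (star ψ)) := by
  refine ⟨Matrix.posSemidef_vecMulVec_self_star ψ, ?_⟩
  have : ∀ j, ψ j * star (ψ j) = ((‖ψ j‖ ^ 2 : ℝ) : ℂ) := fun j => by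
    rw [Complex.star_def, Complex.mul_conj, Complex.normSq_eq_norm_sq]
  simp only [Matrix.trace, Matrix.diag, Matrix.vecMulVec_apply, Pi.star_apply, this]
  rw [← Complex.ofReal_sum, h, Complex.ofReal_one]

lemma sqrt2C : ((Real.sqrt 2 : ℝ) : ℂ) * ((Real.sqrt 2 : ℝ) : ℂ) = 2 := by
  rw [← Complex.ofReal_mul, Real.mul_self_sqrt (by norm_num)]; simp

noncomputable def LamEx (ρ : Matrix (Fin 2) (Fin 2) ℂ) : Matrix (Fin 2) (Fin 2) ℂ :=
  E1ex * ρ * E1exᴴ + E2ex * ρ * E2exᴴ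

lemma LamEx_density (ρ : Matrix (Fin 2) (Fin 2) ℂ) (h : IsDensityMatrix ρ) :
    IsDensityMatrix (LamEx ρ) := by
  refine ⟨(h.1.mul_mul_conjTranspose_same _).add (h.1.mul_mul_conjTranspose_same _), ?_⟩
  have h2 := h.2
  rw [← h2]
  have := sqrt2C
  simp only [LamEx, E1ex, E2ex, Matrix.trace_fin_two, Matrix.mul_apply, Fin.sum_univ_two, Matrix.add_apply,
    Matrix.conjTranspose_apply, Matrix.smul_apply]
  simp
  linear_combination (1/2 * ρ 1 1) * this

lemma LamEx_01 (ρ : Matrix (Fin 2) (Fin 2) ℂ) :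
    LamEx ρ 0 1 = (Real.sqrt 2 : ℂ) / 4 * (ρ 0 1 + ρ 1 0) := by
  simp only [LamEx, E1ex, E2ex, Matrix.mul_apply, Fin.sum_univ_two, Matrix.add_apply,
    Matrix.conjTranspose_apply, Matrix.smul_apply]
  simp
  ring

lemma LamEx_norm (ρ : Matrix (Fin 2) (Fin 2) ℂ) (h : ρ.IsHermitian) :
    ‖LamEx ρ 0 1‖ ≤ ‖ρ 0 1‖ := by
  rw [LamEx_01, norm_mul]
  have h1 : ‖ρ 0 1 + ρ 1 0‖ ≤ 2 * ‖ρ 0 1‖ := by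
    refine (norm_add_le _ _).trans ?_
    rw [← h.apply 1 0, norm_star]; linarith
  have h2 : ‖(Real.sqrt 2 : ℂ) / 4‖ ≤ 1 / 2 := by
    have : Real.sqrt 2 ≤ 2 := by rw [Real.sqrt_le_left (by norm_num)]; norm_num
    simp [abs_of_nonneg (Real.sqrt_nonneg 2)]
    linarith
  have := mul_le_mul h2 h1 (norm_nonneg _) (by norm_num)
  linarith

lemma LamEx_sum {m : ℕ} (p : Fin m → ℝ) (M : Fin m → Matrix (Fin 2) (Fin 2) ℂ) :
    LamEx (∑ i, (p i : ℂ) • M i) = ∑ i, (p i : ℂ) • LamEx (M i) := by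
  simp [LamEx, Finset.mul_sum, Finset.sum_mul, Finset.sum_add_distrib]

lemma LamEx_mono (ρ : Matrix (Fin 2) (Fin 2) ℂ) (h : IsDensityMatrix ρ) :
    Cf (LamEx ρ) ≤ Cf ρ := by
  rw [Cf_eq ρ]
  apply le_csInf
  · obtain ⟨w, φ, h1, h2, h3, h4, -⟩ := qubit_decomp ρ h
    exact ⟨_, mem_CfSet ρ w φ h1 h2 h3 h4⟩
  rintro x ⟨m, p, ψ, hp, hs, hn, hρ, rfl⟩
  have hd := fun i => qubit_decomp _ (LamEx_density _ (isDensity_pure (ψ i) (hn i)))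
  choose w φ h1 h2 h3 h4 h5 using hd
  have hmem := mem_CfSet (LamEx ρ) (fun x : Fin m × Fin 2 => p x.1 * w x.1 x.2)
    (fun x => φ x.1 x.2) (fun x => mul_nonneg (hp _).le (h1 _ _))
    (by rw [Fintype.sum_prod_type]; simp only [← Finset.mul_sum, h2, mul_one, hs])
    (fun x => h3 _ _)
    (by
      rw [Fintype.sum_prod_type, hρ, LamEx_sum]
      apply Finset.sum_congr rfl
      intro i _
      conv_lhs => rw [h4 i]
      rw [Finset.smul_sum]
      apply Finset.sum_congr rfl
      intro k _
      rw [smul_smul, Complex.ofReal_mul])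
  refine (csInf_le ⟨0, CfSet_nonneg _⟩ hmem).trans ?_
  rw [Fintype.sum_prod_type]
  apply Finset.sum_le_sum
  intro i _
  have hle : ∀ k, shannon2 (fun j => ‖φ i k j‖ ^ 2) ≤ shannon2 (fun j => ‖ψ i j‖ ^ 2) := by
    intro k
    apply shannon2_qubit_mono _ _ (h3 i k) (hn i)
    rw [h5 i k]
    have := LamEx_norm _ (isDensity_pure (ψ i) (hn i)).1.isHermitian
    rw [Matrix.vecMulVec_apply, norm_mul, Pi.star_apply, norm_star] at this
    rw [← mul_pow]
    exact pow_le_pow_left₀ (norm_nonneg _) this 2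
  calc ∑ k, p i * w i k * shannon2 (fun j => ‖φ i k j‖ ^ 2)
      ≤ ∑ k, p i * w i k * shannon2 (fun j => ‖ψ i j‖ ^ 2) :=
        Finset.sum_le_sum fun k _ =>
          mul_le_mul_of_nonneg_left (hle k) (mul_nonneg (hp i).le (h1 i k))
    _ = _ := by rw [← Finset.sum_mul, ← Finset.mul_sum, h2, mul_one]

noncomputable def Lbig (ρ : Matrix (Fin 2 × Fin 2) (Fin 2 × Fin 2) ℂ) :
    Matrix (Fin 2 × Fin 2) (Fin 2 × Fin 2) ℂ :=
  ((1 : Matrix (Fin 2) (Fin 2) ℂ) ⊗ₖ E1ex) * ρ * ((1 : Matrix (Fin 2) (Fin 2) ℂ) ⊗ₖ E1ex)ᴴ +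
      ((1 : Matrix (Fin 2) (Fin 2) ℂ) ⊗ₖ E2ex) * ρ * ((1 : Matrix (Fin 2) (Fin 2) ℂ) ⊗ₖ E2ex)ᴴ

/-- the maximally entangled input -/
noncomputable def bell : Fin 2 × Fin 2 → ℂ := fun x => if x.1 = x.2 then (Real.sqrt 2 : ℂ) / 2 else 0

noncomputable def outv : Fin 2 → Fin 2 × Fin 2 → ℂ := fun k x =>
  ![![![1 / 2, -1 / 2], ![0, (Real.sqrt 2 : ℂ) / 2]],
    ![![1 / 2, 1 / 2], ![(Real.sqrt 2 : ℂ) / 2, 0]]] k x.1 x.2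

lemma norm_s2 : ‖(Real.sqrt 2 : ℂ) / 2‖ ^ 2 = 1 / 2 := by
  simp [div_pow]; norm_num

lemma bell_norm : ∑ j, ‖bell j‖ ^ 2 = 1 := by
  rw [Fintype.sum_prod_type]
  simp only [Fin.sum_univ_two, bell]
  simp [div_pow]; norm_num

lemma bell_shannon : shannon2 (fun j => ‖bell j‖ ^ 2) = 1 := by
  have h : ∀ j : Fin 2 × Fin 2, ‖bell j‖ ^ 2 = if j.1 = j.2 then 1 / 2 else 0 := by
    intro j
    unfold bell
    split_ifs
    · exact norm_s2
    · simp
  have hl : Real.logb 2 (1 / 2) = -1 := by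
    rw [one_div, Real.logb_inv, Real.logb_self_eq_one (by norm_num)]
  simp only [h]
  unfold shannon2
  rw [Fintype.sum_prod_type]
  simp only [Fin.sum_univ_two]
  simp only [hl, if_true, Fin.zero_eq_one_iff, Fin.one_eq_zero_iff]
  norm_num

lemma Cf_bell : Cf (Matrix.vecMulVec bell (star bell)) ≤ 1 := by
  have := mem_CfSet (Matrix.vecMulVec bell (star bell)) (fun _ : Fin 1 => 1) (fun _ => bell)
    (fun _ => zero_le_one) (by simp) (fun _ => bell_norm) (by simp)
  simp only [bell_shannon] at this
  exact (csInf_le ⟨0, CfSet_nonneg _⟩ this).trans (by simp)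

lemma outv_norm (k : Fin 2) : ∑ j, ‖outv k j‖ ^ 2 = 1 := by
  rw [Fintype.sum_prod_type]
  simp only [Fin.sum_univ_two, outv]
  fin_cases k <;> simp [div_pow] <;> norm_num

lemma Lbig_bell : Lbig (Matrix.vecMulVec bell (star bell)) =
    ∑ k : Fin 2, ((1 / 2 : ℝ) : ℂ) • Matrix.vecMulVec (outv k) (star (outv k)) := by
  have e : ∀ A : Matrix (Fin 2 × Fin 2) (Fin 2 × Fin 2) ℂ,
      A * Matrix.vecMulVec bell (star bell) * Aᴴ = Matrix.vecMulVec (A *ᵥ bell) (star (A *ᵥ bell)) := by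
    intro A
    rw [Matrix.mul_vecMulVec, Matrix.vecMulVec_mul, Matrix.star_mulVec]
  have h0 : ((1 : Matrix (Fin 2) (Fin 2) ℂ) ⊗ₖ E1ex) *ᵥ bell = ((Real.sqrt 2 : ℂ) / 2) • outv 0 := by
    ext ⟨i, j⟩
    have := sqrt2C
    fin_cases i <;> fin_cases j <;>
      simp [Matrix.mulVec, dotProduct, Fintype.sum_prod_type, E1ex, bell, outv] <;> ring
  have h1 : ((1 : Matrix (Fin 2) (Fin 2) ℂ) ⊗ₖ E2ex) *ᵥ bell = ((Real.sqrt 2 : ℂ) / 2) • outv 1 := by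
    ext ⟨i, j⟩
    have := sqrt2C
    fin_cases i <;> fin_cases j <;>
      simp [Matrix.mulVec, dotProduct, Fintype.sum_prod_type, E2ex, bell, outv] <;> ring
  have hc : (Real.sqrt 2 : ℂ) / 2 * ((Real.sqrt 2 : ℂ) / 2) = 1 / 2 := by
    linear_combination (1 / 4 : ℂ) * sqrt2C
  have hv : ∀ v : Fin 2 × Fin 2 → ℂ, Matrix.vecMulVec (((Real.sqrt 2 : ℂ) / 2) • v)
      (star (((Real.sqrt 2 : ℂ) / 2) • v)) = ((1 / 2 : ℝ) : ℂ) • Matrix.vecMulVec v (star v) := by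
    intro v
    ext i j
    simp [Matrix.vecMulVec_apply]
    linear_combination (v i * (starRingEnd ℂ) (v j)) * hc
  unfold Lbig
  rw [e, e, h0, h1, hv, hv, Fin.sum_univ_two]

/-- A vector annihilating a mixture annihilates each of its members. -/
lemma kernel_mem {n : Type*} [Fintype n] {m k : ℕ} (p : Fin m → ℝ) (ψ : Fin m → n → ℂ)
    (hp : ∀ i, 0 < p i) (q : Fin k → ℝ) (φ : Fin k → n → ℂ)
    (h : ∑ i, (q i : ℂ) • Matrix.vecMulVec (φ i) (star (φ i)) =
      ∑ i, (p i : ℂ) • Matrix.vecMulVec (ψ i) (star (ψ i)))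
    (w : n → ℂ) (hw : ∀ i, w ⬝ᵥ φ i = 0) (i : Fin m) : w ⬝ᵥ ψ i = 0 := by
  have key : ∀ {l : ℕ} (p : Fin l → ℝ) (ψ : Fin l → n → ℂ),
      w ⬝ᵥ ((∑ i, (p i : ℂ) • Matrix.vecMulVec (ψ i) (star (ψ i))) *ᵥ star w) =
        ((∑ i, p i * ‖w ⬝ᵥ ψ i‖ ^ 2 : ℝ) : ℂ) := by
    intro l p ψ
    rw [Matrix.sum_mulVec, dotProduct_sum, Complex.ofReal_sum]
    apply Finset.sum_congr rfl
    intro i _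
    rw [Matrix.smul_mulVec, Matrix.vecMulVec_mulVec, dotProduct_smul]
    have : star (ψ i) ⬝ᵥ star w = star (w ⬝ᵥ ψ i) := by
      rw [Matrix.star_dotProduct_star]
    rw [this]
    simp only [op_smul_eq_mul, smul_eq_mul, dotProduct_smul]
    rw [Complex.star_def, Complex.mul_conj, Complex.normSq_eq_norm_sq]
    push_cast; rfl
  have h1 := key q φ
  rw [h, key p ψ] at h1
  simp only [hw] at h1
  have h2 : ∑ i, p i * ‖w ⬝ᵥ ψ i‖ ^ 2 = 0 := by
    have := Complex.ofReal_injective h1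
    simpa using this
  rw [Finset.sum_eq_zero_iff_of_nonneg (fun i _ => mul_nonneg (hp i).le (by positivity))] at h2
  have := h2 i (Finset.mem_univ i)
  have hpi := hp i
  have h3 : ‖w ⬝ᵥ ψ i‖ ^ 2 = 0 := by
    rcases mul_eq_zero.mp this with h | h
    · linarith
    · exact h
  simpa using h3

lemma entropy_term {x : ℝ} (hx : 0 ≤ x) : x + x * (1 - 2 * x) ≤ -(x * Real.logb 2 x) ∨ 1 / 2 < x := by
  by_cases h : 1 / 2 < x
  · exact Or.inr h
  left
  push Not at h
  rcases hx.eq_or_lt with h0 | h0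
  · rw [← h0]; simp
  have hl : 0 < Real.log 2 := Real.log_pos (by norm_num)
  have hl1 : Real.log 2 ≤ 1 := by
    have := Real.log_two_lt_d9
    linarith
  have h1 : Real.logb 2 (2 * x) ≤ 2 * x - 1 := by
    have h2 : Real.log (2 * x) ≤ 2 * x - 1 := Real.log_le_sub_one_of_pos (by linarith)
    unfold Real.logb
    rw [div_le_iff₀ hl]
    nlinarith
  rw [Real.logb_mul (by norm_num) h0.ne', Real.logb_self_eq_one (by norm_num)] at h1
  nlinarith

lemma out_entropy (f : Fin 2 × Fin 2 → ℂ) (hn : ∑ j, ‖f j‖ ^ 2 = 1)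
    (h1 : f (0, 0) + f (0, 1) = (Real.sqrt 2 : ℂ) * f (1, 0))
    (h2 : f (0, 0) - f (0, 1) = (Real.sqrt 2 : ℂ) * f (1, 1)) :
    5 / 4 ≤ shannon2 (fun j => ‖f j‖ ^ 2) := by
  unfold shannon2
  rw [Fintype.sum_prod_type] at hn ⊢
  simp only [Fin.sum_univ_two] at hn ⊢
  have hs : Real.sqrt 2 * Real.sqrt 2 = 2 := Real.mul_self_sqrt (by norm_num)
  have n1 : ‖f (0, 0) + f (0, 1)‖ ^ 2 = 2 * ‖f (1, 0)‖ ^ 2 := by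
    rw [h1, norm_mul, mul_pow]; simp
  have n2 : ‖f (0, 0) - f (0, 1)‖ ^ 2 = 2 * ‖f (1, 1)‖ ^ 2 := by
    rw [h2, norm_mul, mul_pow]; simp
  have q0 := sq_nonneg ‖f (0, 0)‖
  have q1 := sq_nonneg ‖f (0, 1)‖
  have q2 := sq_nonneg ‖f (1, 0)‖
  have q3 := sq_nonneg ‖f (1, 1)‖
  have hpar : ‖f (0, 0) + f (0, 1)‖ ^ 2 + ‖f (0, 0) - f (0, 1)‖ ^ 2 =
      2 * (‖f (0, 0)‖ ^ 2 + ‖f (0, 1)‖ ^ 2) := by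
    simp only [← Complex.normSq_eq_norm_sq, Complex.normSq_apply, Complex.add_re, Complex.add_im,
      Complex.sub_re, Complex.sub_im]
    ring
  have hcs : (‖f (0, 0) + f (0, 1)‖ ^ 2 - ‖f (0, 0) - f (0, 1)‖ ^ 2) ^ 2 ≤
      16 * (‖f (0, 0)‖ ^ 2 * ‖f (0, 1)‖ ^ 2) := by
    simp only [← Complex.normSq_eq_norm_sq, Complex.normSq_apply, Complex.add_re, Complex.add_im,
      Complex.sub_re, Complex.sub_im]
    nlinarith [sq_nonneg ((f (0, 0)).re * (f (0, 1)).im - (f (0, 0)).im * (f (0, 1)).re)]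
  rw [n1, n2] at hpar hcs
  have t0 := entropy_term q0
  have t1 := entropy_term q1
  have t2 := entropy_term q2
  have t3 := entropy_term q3
  generalize ‖f (0, 0)‖ ^ 2 = a at *
  generalize ‖f (0, 1)‖ ^ 2 = b at *
  generalize ‖f (1, 0)‖ ^ 2 = c at *
  generalize ‖f (1, 1)‖ ^ 2 = d at *
  replace t0 := t0.resolve_right (by linarith)
  replace t1 := t1.resolve_right (by linarith)
  replace t2 := t2.resolve_right (by linarith)
  replace t3 := t3.resolve_right (by linarith)
  have hb : b = 1 / 2 - a := by linarith
  have hd : d = 1 / 2 - c := by linarith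
  have hq : a ^ 2 + b ^ 2 + c ^ 2 + d ^ 2 ≤ 3 / 8 := by
    subst hb hd
    nlinarith
  linarith

lemma Cf_out : 5 / 4 ≤ Cf (Lbig (Matrix.vecMulVec bell (star bell))) := by
  rw [Cf_eq]
  apply le_csInf
  · exact ⟨_, mem_CfSet _ (fun _ : Fin 2 => 1 / 2) outv (fun _ => by norm_num) (by norm_num)
      outv_norm Lbig_bell⟩
  rintro x ⟨m, p, ψ, hp, hs, hn, hρ, rfl⟩
  rw [Lbig_bell] at hρ
  have hk := kernel_mem p ψ hp (fun _ : Fin 2 => 1 / 2) outv hρ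
  have hE : ∀ i, 5 / 4 ≤ shannon2 (fun j => ‖ψ i j‖ ^ 2) := by
    intro i
    apply out_entropy _ (hn i)
    · have := hk (fun x => ![![1, 1], ![-(Real.sqrt 2 : ℂ), 0]] x.1 x.2) (by
        intro k
        have := sqrt2C
        fin_cases k <;> simp [dotProduct, Fintype.sum_prod_type, outv]
        all_goals first | ring1 | linear_combination (-1 / 2 : ℂ) * this) i
      simp [dotProduct, Fintype.sum_prod_type] at this
      linear_combination this
    · have := hk (fun x => ![![1, -1], ![0, -(Real.sqrt 2 : ℂ)]] x.1 x.2) (by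
        intro k
        have := sqrt2C
        fin_cases k <;> simp [dotProduct, Fintype.sum_prod_type, outv]
        all_goals first | ring1 | linear_combination (-1 / 2 : ℂ) * this) i
      simp [dotProduct, Fintype.sum_prod_type] at this
      linear_combination this
  calc (5 / 4 : ℝ) = ∑ i, p i * (5 / 4) := by rw [← Finset.sum_mul, hs, one_mul]
    _ ≤ _ := Finset.sum_le_sum fun i _ => mul_le_mul_of_nonneg_left (hE i) (hp i).le

lemma exists_density_zero : ∃ ρ : Matrix (Fin 2) (Fin 2) ℂ, IsDensityMatrix ρ ∧ Cf ρ = 0 := by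
  have hn : ∑ j, ‖(![1, 0] : Fin 2 → ℂ) j‖ ^ 2 = 1 := by simp
  refine ⟨Matrix.vecMulVec ![1, 0] (star ![1, 0]), isDensity_pure _ hn, ?_⟩
  apply le_antisymm _ (Cf_nonneg _)
  have := mem_CfSet (Matrix.vecMulVec ![1, 0] (star ![1, 0])) (fun _ : Fin 1 => 1)
    (fun _ => (![1, 0] : Fin 2 → ℂ)) (fun _ => zero_le_one) (by simp) (fun _ => hn)
    (by simp only [Finset.univ_unique, Finset.sum_singleton, Complex.ofReal_one, one_smul])
  refine (csInf_le ⟨0, CfSet_nonneg _⟩ this).trans ?_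
  simp [shannon2]

/-- The coherence-increasing power (w.r.t. `C_f`) vanishes for the identity qubit channel
and for the example channel `Λ_ex`, yet is strictly positive for `id₂ ⊗ Λ_ex`. -/
theorem cohPower_superadditive_example :
    cohPower Cf (fun ρ : Matrix (Fin 2) (Fin 2) ℂ => ρ) = 0 ∧
    cohPower Cf (fun ρ : Matrix (Fin 2) (Fin 2) ℂ =>
      E1ex * ρ * E1exᴴ + E2ex * ρ * E2exᴴ) = 0 ∧
    0 < cohPower Cf (fun ρ : Matrix (Fin 2 × Fin 2) (Fin 2 × Fin 2) ℂ =>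
      ((1 : Matrix (Fin 2) (Fin 2) ℂ) ⊗ₖ E1ex) * ρ * ((1 : Matrix (Fin 2) (Fin 2) ℂ) ⊗ₖ E1ex)ᴴ +
      ((1 : Matrix (Fin 2) (Fin 2) ℂ) ⊗ₖ E2ex) * ρ * ((1 : Matrix (Fin 2) (Fin 2) ℂ) ⊗ₖ E2ex)ᴴ) := by
  obtain ⟨ρ₀, hρ₀, hC₀⟩ := exists_density_zero
  refine ⟨?_, ?_, ?_⟩
  · unfold cohPower
    have : { x : ℝ | ∃ ρ : Matrix (Fin 2) (Fin 2) ℂ, IsDensityMatrix ρ ∧ x = Cf ρ - Cf ρ } = {0} := by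
      ext x
      constructor
      · rintro ⟨ρ, -, h⟩
        simpa using h
      · intro h
        exact ⟨ρ₀, hρ₀, by simpa using h⟩
    rw [this, csSup_singleton]
  · change sSup { x : ℝ | ∃ ρ, IsDensityMatrix ρ ∧ x = Cf (LamEx ρ) - Cf ρ } = 0
    have hub : ∀ x ∈ { x : ℝ | ∃ ρ, IsDensityMatrix ρ ∧ x = Cf (LamEx ρ) - Cf ρ }, x ≤ 0 := by
      rintro x ⟨ρ, hρ, rfl⟩
      linarith [LamEx_mono ρ hρ]
    apply le_antisymm (Real.sSup_nonpos hub)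
    have hmem : Cf (LamEx ρ₀) - Cf ρ₀ ∈
        { x : ℝ | ∃ ρ, IsDensityMatrix ρ ∧ x = Cf (LamEx ρ) - Cf ρ } := ⟨ρ₀, hρ₀, rfl⟩
    refine le_trans ?_ (le_csSup ⟨0, hub⟩ hmem)
    rw [hC₀, sub_zero]
    exact Cf_nonneg _
  · change 0 < sSup { x : ℝ | ∃ ρ, IsDensityMatrix ρ ∧ x = Cf (Lbig ρ) - Cf ρ }
    have hmem : Cf (Lbig (Matrix.vecMulVec bell (star bell))) -
        Cf (Matrix.vecMulVec bell (star bell)) ∈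
        { x : ℝ | ∃ ρ, IsDensityMatrix ρ ∧ x = Cf (Lbig ρ) - Cf ρ } :=
      ⟨_, isDensity_pure _ bell_norm, rfl⟩
    refine lt_of_lt_of_le ?_ (le_csSup ⟨Fintype.card (Fin 2 × Fin 2) * (1 / Real.log 2), ?_⟩ hmem)
    · linarith [Cf_out, Cf_bell]
    · rintro x ⟨ρ, -, rfl⟩
      linarith [Cf_le_card (Lbig ρ), Cf_nonneg ρ]
end

section
/- Let ρ₂ be a 2×2 density matrix that is coherent (⟨0|ρ₂|1⟩ ≠ 0) and mixed (ρ₂² ≠ ρ₂). Then the coherence of formation strictly exceeds the relative entropy of coherence: C_f(ρ₂) > C_r(ρ₂). -/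
open Matrix BigOperators Kronecker ComplexOrder

/-- `log (1+x) - log (1-x)`, twice the inverse hyperbolic tangent. -/
noncomputable def LL (x : ℝ) : ℝ := Real.log (1 + x) - Real.log (1 - x)

lemma LL_hasDeriv {x : ℝ} (h0 : -1 < x) (h1 : x < 1) : HasDerivAt LL (2 / (1 - x ^ 2)) x := by
  have a : (1 + x) ≠ 0 := by linarith
  have b : (1 - x) ≠ 0 := by linarith
  have h := (((hasDerivAt_id x).const_add 1).log a).sub (((hasDerivAt_id x).const_sub 1).log b)
  refine h.congr_deriv ?_
  have c : (1 - x ^ 2) ≠ 0 := by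
    have : 1 - x ^ 2 = (1 + x) * (1 - x) := by ring
    rw [this]; exact mul_ne_zero a b
  simp only [id]
  field_simp
  ring

lemma LL_zero : LL 0 = 0 := by simp [LL]

lemma LL_gt {x : ℝ} (h0 : 0 < x) (h1 : x < 1) : 2 * x < LL x := by
  have hd : ∀ y ∈ Set.Ico (0:ℝ) 1,
      HasDerivAt (fun y => LL y - 2 * y) (2 / (1 - y ^ 2) - 2 * 1) y := fun y hy =>
    (LL_hasDeriv (by linarith [hy.1]) hy.2).sub ((hasDerivAt_id y).const_mul 2)
  have hm : StrictMonoOn (fun y => LL y - 2 * y) (Set.Ico (0:ℝ) 1) := by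
    apply strictMonoOn_of_deriv_pos (convex_Ico 0 1)
    · exact fun y hy => (hd y hy).continuousAt.continuousWithinAt
    · intro y hy
      rw [interior_Ico] at hy
      rw [(hd y ⟨hy.1.le, hy.2⟩).deriv]
      have : 0 < 1 - y ^ 2 := by nlinarith [hy.1, hy.2]
      have e : 2 / (1 - y ^ 2) - 2 * 1 = 2 * y ^ 2 / (1 - y ^ 2) := by field_simp; ring
      rw [e]
      have := hy.1
      positivity
  have := hm (show (0:ℝ) ∈ Set.Ico (0:ℝ) 1 by simp) ⟨h0.le, h1⟩ h0
  simp only [LL_zero] at this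
  linarith

lemma LL_lt {x : ℝ} (h0 : 0 < x) (h1 : x < 1) : LL x < 2 * x / (1 - x ^ 2) := by
  have hd : ∀ y ∈ Set.Ico (0:ℝ) 1,
      HasDerivAt (fun y => 2 * y / (1 - y ^ 2) - LL y) (4 * y ^ 2 / (1 - y ^ 2) ^ 2) y := by
    intro y hy
    have : 0 < 1 - y ^ 2 := by nlinarith [hy.1, hy.2]
    have h := (((hasDerivAt_id y).const_mul 2).div (((hasDerivAt_id y).pow 2).const_sub 1)
      (by simpa using this.ne')).sub (LL_hasDeriv (by linarith [hy.1]) hy.2)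
    refine h.congr_deriv ?_
    simp only [id, Pi.pow_apply]
    field_simp
    push_cast
    ring
  have hm : StrictMonoOn (fun y => 2 * y / (1 - y ^ 2) - LL y) (Set.Ico (0:ℝ) 1) := by
    apply strictMonoOn_of_deriv_pos (convex_Ico 0 1)
    · exact fun y hy => (hd y hy).continuousAt.continuousWithinAt
    · intro y hy
      rw [interior_Ico] at hy
      rw [(hd y ⟨hy.1.le, hy.2⟩).deriv]
      have : 0 < 1 - y ^ 2 := by nlinarith [hy.1, hy.2]
      have := hy.1
      positivity
  have := hm (show (0:ℝ) ∈ Set.Ico (0:ℝ) 1 by simp) ⟨h0.le, h1⟩ h0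
  simp only [LL_zero] at this
  norm_num at this
  linarith

lemma LL_div_mono : StrictMonoOn (fun x => LL x / x) (Set.Ioo (0:ℝ) 1) := by
  have hd : ∀ y ∈ Set.Ioo (0:ℝ) 1,
      HasDerivAt (fun y => LL y / y) ((2 / (1 - y ^ 2) * y - LL y * 1) / y ^ 2) y := fun y hy =>
    (LL_hasDeriv (by linarith [hy.1]) hy.2).div (hasDerivAt_id y) hy.1.ne'
  apply strictMonoOn_of_deriv_pos (convex_Ioo 0 1)
  · exact fun y hy => (hd y hy).continuousAt.continuousWithinAt
  · intro y hy
    rw [interior_Ioo] at hy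
    rw [(hd y hy).deriv]
    have := LL_lt hy.1 hy.2
    have h2 : 2 / (1 - y ^ 2) * y = 2 * y / (1 - y ^ 2) := by ring
    rw [h2]
    apply div_pos (by linarith) (pow_pos hy.1 2)

lemma LL_sqrt_anti :
    AntitoneOn (fun x => LL x / x * Real.sqrt (1 - x ^ 2)) (Set.Ioo (0:ℝ) 1) := by
  have hd : ∀ y ∈ Set.Ioo (0:ℝ) 1,
      HasDerivAt (fun y => LL y / y * Real.sqrt (1 - y ^ 2))
        ((2 * y - LL y) / (y ^ 2 * Real.sqrt (1 - y ^ 2))) y := by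
    intro y hy
    have hp : 0 < 1 - y ^ 2 := by nlinarith [hy.1, hy.2]
    have h := ((LL_hasDeriv (by linarith [hy.1]) hy.2).div (hasDerivAt_id y) hy.1.ne').mul
      ((((hasDerivAt_id y).pow 2).const_sub 1).sqrt (by simpa using hp.ne'))
    refine h.congr_deriv ?_
    simp only [id, Pi.pow_apply, Pi.div_apply]
    have hy0 := hy.1.ne'
    have hs : Real.sqrt (1 - y ^ 2) ≠ 0 := (Real.sqrt_pos.2 hp).ne'
    have hq : Real.sqrt (1 - y ^ 2) ^ 2 = 1 - y ^ 2 := Real.sq_sqrt hp.le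
    field_simp
    rw [hq]
    field_simp
    push_cast
    ring
  apply antitoneOn_of_deriv_nonpos (convex_Ioo 0 1)
  · exact fun y hy => (hd y hy).continuousAt.continuousWithinAt
  · rw [interior_Ioo]
    exact fun y hy => (hd y hy).differentiableAt.differentiableWithinAt
  · intro y hy
    rw [interior_Ioo] at hy
    rw [(hd y hy).deriv]
    have := LL_gt hy.1 hy.2
    apply div_nonpos_of_nonpos_of_nonneg (by linarith) (by positivity)

lemma binEntropy_hasDeriv {x : ℝ} (h0 : 0 < x) (h1 : x < 1) :
    HasDerivAt Real.binEntropy (-LL x) ((1 + x) / 2) := by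
  have h := Real.hasDerivAt_binEntropy (p := (1 + x) / 2) (by linarith) (by linarith)
  refine h.congr_deriv ?_
  have e : 1 - (1 + x) / 2 = (1 - x) / 2 := by ring
  rw [e, Real.log_div (by linarith) two_ne_zero, Real.log_div (by linarith) two_ne_zero, LL]
  ring

noncomputable def ff (t : ℝ) : ℝ := Real.binEntropy ((1 + Real.sqrt t) / 2)

lemma ff_continuous : Continuous ff := by unfold ff; fun_prop

lemma ff_hasDeriv {t : ℝ} (h0 : 0 < t) (h1 : t < 1) :
    HasDerivAt ff (-(LL (Real.sqrt t) / Real.sqrt t) / 4) t := by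
  have hs := Real.sqrt_pos.2 h0
  have hs1 : Real.sqrt t < 1 := by rw [Real.sqrt_lt' one_pos]; simpa using h1
  have h := (binEntropy_hasDeriv hs hs1).comp t
    (((Real.hasDerivAt_sqrt h0.ne').const_add 1).div_const 2)
  refine h.congr_deriv ?_
  field_simp
  ring

lemma ff_strictConcave : StrictConcaveOn ℝ (Set.Icc (0:ℝ) 1) ff := by
  apply StrictAntiOn.strictConcaveOn_of_deriv (convex_Icc 0 1) ff_continuous.continuousOn
  rw [interior_Icc]
  intro a ha b hb hab
  rw [(ff_hasDeriv ha.1 ha.2).deriv, (ff_hasDeriv hb.1 hb.2).deriv]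
  have m : ∀ t ∈ Set.Ioo (0:ℝ) 1, Real.sqrt t ∈ Set.Ioo (0:ℝ) 1 := fun t ht =>
    ⟨Real.sqrt_pos.2 ht.1, by rw [Real.sqrt_lt' one_pos]; simpa using ht.2⟩
  have := LL_div_mono (m a ha) (m b hb) (Real.sqrt_lt_sqrt ha.1.le hab)
  simp only at this
  linarith

lemma ff_one : ff 1 = 0 := by simp [ff]

lemma ff_anti : AntitoneOn ff (Set.Icc (0:ℝ) 1) := by
  intro a ha b hb hab
  have m : ∀ t ∈ Set.Icc (0:ℝ) 1, (1 + Real.sqrt t) / 2 ∈ Set.Icc (2⁻¹:ℝ) 1 := fun t ht => by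
    have h1 := Real.sqrt_nonneg t
    have h2 : Real.sqrt t ≤ 1 := Real.sqrt_le_one.2 ht.2
    constructor <;> linarith
  apply Real.binEntropy_strictAntiOn.antitoneOn (m a ha) (m b hb)
  have := Real.sqrt_le_sqrt hab
  linarith

lemma kk_convex : ConvexOn ℝ (Set.Icc (0:ℝ) 1) (fun c => ff (1 - c ^ 2)) := by
  have hd : ∀ c ∈ Set.Ioo (0:ℝ) 1, HasDerivAt (fun c => ff (1 - c ^ 2))
      (LL (Real.sqrt (1 - c ^ 2)) / Real.sqrt (1 - c ^ 2)
        * Real.sqrt (1 - Real.sqrt (1 - c ^ 2) ^ 2) / 2) c := by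
    intro c hc
    have hp : 0 < 1 - c ^ 2 := by nlinarith [hc.1, hc.2]
    have hp1 : 1 - c ^ 2 < 1 := by nlinarith [hc.1, hc.2]
    have h := (ff_hasDeriv hp hp1).comp c (((hasDerivAt_id c).pow 2).const_sub 1)
    refine h.congr_deriv ?_
    rw [Real.sq_sqrt hp.le]
    have : Real.sqrt (1 - (1 - c ^ 2)) = c := by
      rw [sub_sub_cancel, Real.sqrt_sq hc.1.le]
    rw [this]
    simp only [id]
    push_cast
    ring
  have m : ∀ c ∈ Set.Ioo (0:ℝ) 1, Real.sqrt (1 - c ^ 2) ∈ Set.Ioo (0:ℝ) 1 := fun c hc => by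
    have hp : 0 < 1 - c ^ 2 := by nlinarith [hc.1, hc.2]
    have hp1 : 1 - c ^ 2 < 1 := by nlinarith [hc.1, hc.2]
    exact ⟨Real.sqrt_pos.2 hp, by rw [Real.sqrt_lt' one_pos]; rw [one_pow]; exact hp1⟩
  apply MonotoneOn.convexOn_of_deriv (convex_Icc 0 1)
  · exact (ff_continuous.comp (by fun_prop)).continuousOn
  · rw [interior_Icc]
    exact fun y hy => (hd y hy).differentiableAt.differentiableWithinAt
  · rw [interior_Icc]
    intro a ha b hb hab
    rw [(hd a ha).deriv, (hd b hb).deriv]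
    have := LL_sqrt_anti (m b hb) (m a ha)
      (Real.sqrt_le_sqrt (by nlinarith [ha.1, hb.1] : 1 - b ^ 2 ≤ 1 - a ^ 2))
    simp only at this
    linarith

lemma ff_key {u s : ℝ} (hu : 0 ≤ u) (hs : 0 < s) (h : u + s < 1) :
    ff u - ff (u + s) < ff (1 - s) := by
  have hd : 0 < 1 - u := by linarith
  have a := ff_strictConcave.2 (show u ∈ Set.Icc (0:ℝ) 1 from ⟨hu, by linarith⟩)
    (show (1:ℝ) ∈ Set.Icc (0:ℝ) 1 by simp) (by linarith)
    (show 0 < (1 - u - s) / (1 - u) from div_pos (by linarith) hd)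
    (show 0 < s / (1 - u) from div_pos hs hd) (by field_simp; ring)
  have b := ff_strictConcave.2 (show u ∈ Set.Icc (0:ℝ) 1 from ⟨hu, by linarith⟩)
    (show (1:ℝ) ∈ Set.Icc (0:ℝ) 1 by simp) (by linarith)
    (show 0 < s / (1 - u) from div_pos hs hd)
    (show 0 < (1 - u - s) / (1 - u) from div_pos (by linarith) hd) (by field_simp; ring)
  simp only [smul_eq_mul, ff_one, mul_zero, add_zero, mul_one] at a b
  have e1 : (1 - u - s) / (1 - u) * u + s / (1 - u) = u + s := by field_simp; ring
  have e2 : s / (1 - u) * u + (1 - u - s) / (1 - u) = 1 - s := by field_simp; ring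
  rw [e1] at a
  rw [e2] at b
  have e3 : (1 - u - s) / (1 - u) * ff u + s / (1 - u) * ff u = ff u := by field_simp; ring
  linarith

lemma shannon2_eq (p : Fin 2 → ℝ) (hp : p 0 + p 1 = 1) :
    shannon2 p = ff (1 - 4 * (p 0 * p 1)) / Real.log 2 := by
  have h1 : p 1 = 1 - p 0 := by linarith
  have e : 1 - 4 * (p 0 * p 1) = (2 * p 0 - 1) ^ 2 := by rw [h1]; ring
  have hb : ff (1 - 4 * (p 0 * p 1)) = Real.binEntropy (p 0) := by
    rw [e, ff, Real.sqrt_sq_eq_abs]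
    rcases abs_choice (2 * p 0 - 1) with h | h <;> rw [h]
    · congr 1; ring
    · rw [← Real.binEntropy_one_sub (p 0)]; congr 1; ring
  rw [hb, Real.binEntropy_eq_negMulLog_add_negMulLog_one_sub, ← h1]
  simp only [shannon2, Fin.sum_univ_two, Real.negMulLog, Real.logb]
  ring

lemma vN_eq (M : Matrix (Fin 2) (Fin 2) ℂ) (hM : M.IsHermitian) (ht : M.trace = 1) :
    vN M = ff (1 - 4 * M.det.re) / Real.log 2 := by
  rw [vN, dif_pos hM]
  have h1 := hM.trace_eq_sum_eigenvalues
  have h2 := hM.det_eq_prod_eigenvalues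
  rw [ht, Fin.sum_univ_two] at h1
  rw [Fin.prod_univ_two] at h2
  rw [shannon2_eq, h2]
  · simp
  · have := congrArg Complex.re h1
    simpa using this.symm

lemma Cf_lower (ρ : Matrix (Fin 2) (Fin 2) ℂ) (m : ℕ) (p : Fin m → ℝ) (ψ : Fin m → Fin 2 → ℂ)
    (hp : ∀ i, 0 < p i) (hs : ∑ i, p i = 1) (hψ : ∀ i, ∑ j, ‖ψ i j‖ ^ 2 = 1)
    (hρ : ρ = ∑ i, (p i : ℂ) • Matrix.vecMulVec (ψ i) (star (ψ i))) :
    ff (1 - (2 * ‖ρ 0 1‖) ^ 2) / Real.log 2 ≤ ∑ i, p i * shannon2 (fun j => ‖ψ i j‖ ^ 2) := by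
  have hl : 0 < Real.log 2 := Real.log_pos one_lt_two
  set c : Fin m → ℝ := fun i => 2 * (‖ψ i 0‖ * ‖ψ i 1‖) with hc
  have hψ' : ∀ i, ‖ψ i 0‖ ^ 2 + ‖ψ i 1‖ ^ 2 = 1 := fun i => by
    rw [← hψ i, Fin.sum_univ_two]
  have hcm : ∀ i, c i ∈ Set.Icc (0:ℝ) 1 := fun i => by
    refine ⟨by positivity, ?_⟩
    have := hψ' i
    simp only [hc]
    nlinarith [sq_nonneg (‖ψ i 0‖ - ‖ψ i 1‖)]
  have e : ∑ i, p i * shannon2 (fun j => ‖ψ i j‖ ^ 2)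
      = (∑ i, p i • ff (1 - c i ^ 2)) / Real.log 2 := by
    rw [Finset.sum_div]
    refine Finset.sum_congr rfl fun i _ => ?_
    rw [shannon2_eq _ (hψ' i), smul_eq_mul, mul_div_assoc]
    simp only [hc]
    congr 4
    ring
  rw [e]
  refine div_le_div_of_nonneg_right ?_ hl.le
  have hj := kk_convex.map_sum_le (t := Finset.univ) (w := p) (p := c)
    (fun i _ => (hp i).le) hs (fun i _ => hcm i)
  refine le_trans ?_ hj
  have hC : ∑ i, p i • c i ∈ Set.Icc (0:ℝ) 1 :=
    (convex_Icc (0:ℝ) 1).sum_mem (fun i _ => (hp i).le) hs (fun i _ => hcm i)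
  have hle : 2 * ‖ρ 0 1‖ ≤ ∑ i, p i • c i := by
    have : ρ 0 1 = ∑ i, (p i : ℂ) * (ψ i 0 * star (ψ i 1)) := by
      rw [hρ, Matrix.sum_apply]
      rfl
    rw [this]
    calc 2 * ‖∑ i, (p i : ℂ) * (ψ i 0 * star (ψ i 1))‖
        ≤ 2 * ∑ i, ‖(p i : ℂ) * (ψ i 0 * star (ψ i 1))‖ := by
          gcongr; exact norm_sum_le _ _
      _ = ∑ i, p i • c i := by
          rw [Finset.mul_sum]
          refine Finset.sum_congr rfl fun i _ => ?_
          rw [norm_mul, norm_mul, norm_star, Complex.norm_real, Real.norm_of_nonneg (hp i).le,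
            smul_eq_mul]
          simp only [hc]; ring
  have h0 : 0 ≤ 2 * ‖ρ 0 1‖ := by positivity
  have h2 := hC.1
  have h3 := hC.2
  generalize ∑ i, p i • c i = C at *
  generalize 2 * ‖ρ 0 1‖ = d at *
  apply ff_anti
  · constructor <;> nlinarith
  · constructor <;> nlinarith
  · nlinarith

lemma decomp_exists (ρ : Matrix (Fin 2) (Fin 2) ℂ) (hρ : IsDensityMatrix ρ) (hd : ρ.det ≠ 0) :
    ∃ (m : ℕ) (p : Fin m → ℝ) (ψ : Fin m → Fin 2 → ℂ),
    (∀ i, 0 < p i) ∧ (∑ i, p i = 1) ∧ (∀ i, ∑ j, ‖ψ i j‖ ^ 2 = 1) ∧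
    ρ = ∑ i, (p i : ℂ) • Matrix.vecMulVec (ψ i) (star (ψ i)) := by
  have hH := hρ.1.isHermitian
  refine ⟨2, hH.eigenvalues, fun i j => hH.eigenvectorBasis i j, ?_, ?_, ?_, ?_⟩
  · intro i
    refine lt_of_le_of_ne (hρ.1.eigenvalues_nonneg i) fun h => hd ?_
    rw [hH.det_eq_prod_eigenvalues]
    exact Finset.prod_eq_zero (Finset.mem_univ i) (by simp [← h])
  · have h1 := hH.trace_eq_sum_eigenvalues
    rw [hρ.2] at h1
    have := congrArg Complex.re h1
    simpa using this.symm
  · intro i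
    rw [← EuclideanSpace.norm_sq_eq, hH.eigenvectorBasis.norm_eq_one, one_pow]
  · have h := hH.spectral_theorem
    rw [Unitary.conjStarAlgAut_apply] at h
    conv_lhs => rw [h]
    ext a b
    rw [Matrix.sum_apply, Matrix.mul_apply]
    refine Finset.sum_congr rfl fun i _ => ?_
    rw [Matrix.mul_diagonal]
    simp only [Matrix.smul_apply, Matrix.vecMulVec_apply, Pi.star_apply, Matrix.star_apply,
      Matrix.IsHermitian.eigenvectorUnitary_apply, Function.comp_apply, smul_eq_mul]
    simp only [Complex.coe_algebraMap]
    ring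

/-- For a coherent mixed qubit state, the coherence of formation strictly exceeds the
relative entropy of coherence. -/
theorem Cf_gt_Cr_of_coherent_mixed_qubit (ρ : Matrix (Fin 2) (Fin 2) ℂ)
    (hρ : IsDensityMatrix ρ) (hcoh : ρ 0 1 ≠ 0) (hmixed : ρ * ρ ≠ ρ) :
    Cr ρ < Cf ρ := by
  have hl : 0 < Real.log 2 := Real.log_pos one_lt_two
  have hH := hρ.1.isHermitian
  have htr := hρ.2
  rw [Matrix.trace_fin_two] at htr
  have hd : ρ.det ≠ 0 := by
    intro h
    rw [Matrix.det_fin_two] at h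
    apply hmixed
    ext i j
    rw [Matrix.mul_apply, Fin.sum_univ_two]
    fin_cases i <;> fin_cases j <;> simp only [Fin.zero_eta, Fin.mk_one, Fin.isValue]
    · linear_combination ρ 0 0 * htr - h
    · linear_combination ρ 0 1 * htr
    · linear_combination ρ 1 0 * htr
    · linear_combination ρ 1 1 * htr - h
  have hdet0 : 0 < ρ.det.re := by
    have h := hρ.1.det_nonneg
    rw [Complex.le_def] at h
    refine lt_of_le_of_ne h.1 fun h' => hd ?_
    exact Complex.ext h'.symm h.2.symm
  have him : ∀ i, (ρ i i).im = 0 := fun i => by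
    have := congrArg Complex.im (hH.apply i i)
    simp only [Complex.star_def, Complex.conj_im] at this
    linarith
  have h10 : ρ 1 0 = star (ρ 0 1) := (hH.apply 1 0).symm
  have hre : (ρ 0 0).re + (ρ 1 1).re = 1 := by simpa using congrArg Complex.re htr
  have hdre : ρ.det.re = (ρ 0 0).re * (ρ 1 1).re - ‖ρ 0 1‖ ^ 2 := by
    rw [Matrix.det_fin_two, h10, ← Complex.normSq_eq_norm_sq]
    simp [him, Complex.normSq_apply]
  have hD : vN (Matrix.diagonal ρ.diag)
      = ff (1 - 4 * ((ρ 0 0).re * (ρ 1 1).re)) / Real.log 2 := by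
    rw [vN_eq]
    · simp [Matrix.det_diagonal, Fin.prod_univ_two, him]
    · rw [Matrix.isHermitian_diagonal_iff]
      intro i
      exact hH.apply i i
    · rw [Matrix.trace_diagonal, Fin.sum_univ_two]
      exact htr
  have hn : 0 < ‖ρ 0 1‖ := norm_pos_iff.2 hcoh
  have key : Cr ρ < ff (1 - (2 * ‖ρ 0 1‖) ^ 2) / Real.log 2 := by
    rw [Cr, hD, vN_eq ρ hH hρ.2, ← sub_div]
    refine div_lt_div_of_pos_right ?_ hl
    have := ff_key (u := 1 - 4 * ((ρ 0 0).re * (ρ 1 1).re)) (s := (2 * ‖ρ 0 1‖) ^ 2)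
      (by nlinarith [sq_nonneg ((ρ 0 0).re - (ρ 1 1).re)]) (by positivity)
      (by nlinarith)
    have e : 1 - 4 * ρ.det.re
        = 1 - 4 * ((ρ 0 0).re * (ρ 1 1).re) + (2 * ‖ρ 0 1‖) ^ 2 := by rw [hdre]; ring
    rw [e]
    exact this
  refine lt_of_lt_of_le key ?_
  refine le_csInf ?_ ?_
  · obtain ⟨m, p, ψ, h1, h2, h3, h4⟩ := decomp_exists ρ hρ hd
    exact ⟨_, m, p, ψ, h1, h2, h3, h4, rfl⟩
  · rintro x ⟨m, p, ψ, h1, h2, h3, h4, rfl⟩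
    exact Cf_lower ρ m p ψ h1 h2 h3 h4
end
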